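/- Let q ≥ 1. Then TP^{(2q,q)}(γ) ≥ π^q for every γ ∈ W^{1,∞}_{i,a}(𝕋, ℝ^n). Furthermore, if q > 1 then equality holds if and only if the image of γ is a round circle, and if q = 1 then equality holds if and only if γ is convex. -/

import Mathlib

open MeasureTheory Real Set intervalIntegral
open scoped ENNReal RealInnerProductSpace

noncomputable section

/-- A closed `W^{1,1}`-curve on the torus `𝕋 = ℝ/ℤ` with values in `ℝⁿ`, encoded as a
`1`-periodic absolutely continuous function `toFun : ℝ → ℝⁿ` together with its
(weak) derivative `deriv'`. -/
structure ClosedCurve (n : ℕ) where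
  toFun : ℝ → EuclideanSpace ℝ (Fin n)
  deriv' : ℝ → EuclideanSpace ℝ (Fin n)
  periodic : Function.Periodic toFun 1
  deriv'_periodic : Function.Periodic deriv' 1
  integrableOn : MeasureTheory.IntegrableOn deriv' (Set.Icc (0:ℝ) 1)
  eq_integral : ∀ t : ℝ, toFun t = toFun 0 + ∫ s in (0:ℝ)..t, deriv' s

namespace ClosedCurve

variable {n : ℕ}

/-- Injectivity as a map on the torus `ℝ/ℤ`. -/
def IsInj (γ : ClosedCurve n) : Prop :=
  ∀ s t : ℝ, γ.toFun s = γ.toFun t → ∃ k : ℤ, s - t = (k : ℝ)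

/-- Regularity: the derivative does not vanish a.e. -/
def IsRegular (γ : ClosedCurve n) : Prop := ∀ᵐ t : ℝ ∂volume, γ.deriv' t ≠ 0

/-- Parametrization by arc length: `|γ'| = 1` a.e. -/
def IsArclength (γ : ClosedCurve n) : Prop := ∀ᵐ t : ℝ ∂volume, ‖γ.deriv' t‖ = 1

/-- The length of a closed curve. -/
def length (γ : ClosedCurve n) : ℝ := ∫ t in (0:ℝ)..1, ‖γ.deriv' t‖

end ClosedCurve

/-- Orthogonal projection onto the orthogonal complement of `span {v}` (for `v ≠ 0`). -/
def projPerp {F : Type*} [NormedAddCommGroup F] [InnerProductSpace ℝ F] (v x : F) : F :=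
  x - (⟪v, x⟫ / ‖v‖ ^ 2) • v

/-- The Gauss map `φ_γ(u,w)`: the unit secant direction. -/
def gaussMap {n : ℕ} (γ : ClosedCurve n) (u w : ℝ) : EuclideanSpace ℝ (Fin n) :=
  ‖γ.toFun (u + w) - γ.toFun u‖⁻¹ • (γ.toFun (u + w) - γ.toFun u)

/-- `|∂_u φ_γ(u,w)|`, expressed via the identity (1.8) of the paper. -/
def gaussDerivU {n : ℕ} (γ : ClosedCurve n) (u w : ℝ) : ℝ :=
  ‖projPerp (gaussMap γ u w) (γ.deriv' (u + w) - γ.deriv' u)‖ /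
    ‖γ.toFun (u + w) - γ.toFun u‖

/-- `|∂_w φ_γ(u,w)|`, expressed via the identity (1.7) of the paper. -/
def gaussDerivW {n : ℕ} (γ : ClosedCurve n) (u w : ℝ) : ℝ :=
  ‖projPerp (gaussMap γ u w) (γ.deriv' (u + w))‖ / ‖γ.toFun (u + w) - γ.toFun u‖

/-- The generalized tangent-point energy `TP^{(p,q)}` (with values in `[0,∞]`). -/
def TP {n : ℕ} (p q : ℝ) (γ : ClosedCurve n) : ℝ≥0∞ :=
  ∫⁻ u in Set.Ioc (0:ℝ) 1, ∫⁻ w in Set.Ioc (0:ℝ) 1,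
    ENNReal.ofReal
      (‖projPerp (γ.deriv' u) (γ.toFun (u + w) - γ.toFun u)‖ ^ q /
        ‖γ.toFun (u + w) - γ.toFun u‖ ^ p * (‖γ.deriv' u‖ * ‖γ.deriv' (u + w)‖))

/-- The minorant `G^{(p,q)}_w`. -/
def Gw {n : ℕ} (p q : ℝ) (γ : ClosedCurve n) (w : ℝ) : ℝ≥0∞ :=
  ∫⁻ u in Set.Ioc (0:ℝ) 1,
    ENNReal.ofReal ((1/2 * gaussDerivU γ u w) ^ q *
      ‖γ.toFun (u + w) - γ.toFun u‖ ^ (2*q - p))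

/-- The minorant `G^{(p,q)}`. -/
def G {n : ℕ} (p q : ℝ) (γ : ClosedCurve n) : ℝ≥0∞ :=
  ∫⁻ w in Set.Ioc (0:ℝ) 1, Gw p q γ w

/-- A round circle in a euclidean space: a sphere intersected with a 2-dimensional plane
through its center. -/
def IsCircle {F : Type*} [NormedAddCommGroup F] [InnerProductSpace ℝ F] (S : Set F) : Prop :=
  ∃ (c : F) (r : ℝ) (V : Submodule ℝ F), 0 < r ∧ Module.finrank ℝ V = 2 ∧
    S = {x | ‖x - c‖ = r ∧ x - c ∈ V}

/-- A great circle of the unit sphere. -/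
def IsGreatCircle {F : Type*} [NormedAddCommGroup F] [InnerProductSpace ℝ F]
    (S : Set F) : Prop :=
  ∃ V : Submodule ℝ F, Module.finrank ℝ V = 2 ∧ S = {x | ‖x‖ = 1 ∧ x ∈ V}

/-- Half of a great circle of the unit sphere: a great-circle arc of angular length `π`. -/
def IsHalfGreatCircle {F : Type*} [NormedAddCommGroup F] [InnerProductSpace ℝ F]
    (S : Set F) : Prop :=
  ∃ a b : F, ‖a‖ = 1 ∧ ‖b‖ = 1 ∧ ⟪a, b⟫ = 0 ∧
    S = (fun t : ℝ => Real.cos t • a + Real.sin t • b) '' Set.Icc 0 π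

/-- A curve is convex if its image is the boundary (within its affine hull) of a convex
planar (2-dimensional) set. -/
def ClosedCurve.IsConvex {n : ℕ} (γ : ClosedCurve n) : Prop :=
  ∃ K : Set (EuclideanSpace ℝ (Fin n)), Convex ℝ K ∧
    Module.finrank ℝ (affineSpan ℝ K).direction = 2 ∧
    Set.range γ.toFun = intrinsicFrontier ℝ K

section Angle

variable {E : Type*} [NormedAddCommGroup E] [InnerProductSpace ℝ E]

theorem norm_projPerp_sq {v : E} (hv : ‖v‖ = 1) (x : E) :
    ‖projPerp v x‖ ^ 2 = ‖x‖ ^ 2 - ⟪v, x⟫ ^ 2 := by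
  rw [projPerp, hv, norm_sub_sq_real, norm_smul, real_inner_smul_right, real_inner_comm, hv]
  simp only [one_pow, div_one, mul_one, Real.norm_eq_abs, sq_abs]
  ring

theorem norm_projPerp_neg (v x : E) : ‖projPerp v (-x)‖ = ‖projPerp v x‖ := by
  rw [← norm_neg, projPerp, projPerp, inner_neg_right, neg_div, neg_smul]
  congr 1
  abel

/-- Away from the origin, angles are Lipschitz in the vectors. -/
theorem angle_le_mul_norm_sub {x y : E} {δ : ℝ} (hδ : 0 < δ) (hx : δ ≤ ‖x‖) (hy : δ ≤ ‖y‖) :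
    InnerProductGeometry.angle x y ≤ π / (2 * δ) * ‖x - y‖ := by
  set θ := InnerProductGeometry.angle x y with hθ
  have h0 : 0 ≤ θ := InnerProductGeometry.angle_nonneg x y
  have h1 : θ ≤ π := InnerProductGeometry.angle_le_pi x y
  have hs : 2 / π * (θ / 2) ≤ sin (θ / 2) :=
    Real.mul_le_sin (by linarith) (by linarith)
  have hs' : θ ≤ π * sin (θ / 2) := by
    have : 2 / π * (θ / 2) = θ / π := by ring
    rw [this, div_le_iff₀ pi_pos] at hs
    linarith
  have hsin : 0 ≤ sin (θ / 2) := sin_nonneg_of_nonneg_of_le_pi (by linarith) (by linarith)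
  have hc : cos θ = 1 - 2 * sin (θ / 2) ^ 2 := by
    have := cos_sq' (θ / 2)
    have h2 := cos_two_mul (θ / 2)
    rw [show 2 * (θ / 2) = θ by ring] at h2
    rw [h2, this]; ring
  have hn : ‖x - y‖ ^ 2 = (‖x‖ - ‖y‖) ^ 2 + 4 * (‖x‖ * ‖y‖) * sin (θ / 2) ^ 2 := by
    rw [norm_sub_sq_real, ← InnerProductGeometry.cos_angle_mul_norm_mul_norm, ← hθ, hc]
    ring
  have hxy : δ * δ ≤ ‖x‖ * ‖y‖ := mul_le_mul hx hy hδ.le (hδ.le.trans hx)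
  have hle : 2 * δ * sin (θ / 2) ≤ ‖x - y‖ := by
    apply le_of_sq_le_sq _ (norm_nonneg _)
    rw [hn]
    nlinarith [mul_le_mul_of_nonneg_right hxy (sq_nonneg (sin (θ / 2))), sq_nonneg (‖x‖ - ‖y‖)]
  calc θ ≤ π * sin (θ / 2) := hs'
    _ = π / (2 * δ) * (2 * δ * sin (θ / 2)) := by field_simp
    _ ≤ _ := mul_le_mul_of_nonneg_left hle (by positivity)

/-- The angle between a fixed vector and a moving vector varies at most as fast as the direction
of the moving vector. -/
theorem abs_deriv_angle_le {v : E} {D : ℝ → E} {d : E} {s A' : ℝ} (hv : v ≠ 0) (hD : D s ≠ 0)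
    (hd : ‖d‖ = 1) (hDd : HasDerivAt D d s)
    (hA : HasDerivAt (fun r => InnerProductGeometry.angle v (D r)) A' s) :
    |A'| ≤ ‖projPerp d (D s)‖ / ‖D s‖ ^ 2 := by
  set θ := InnerProductGeometry.angle v (D s) with hθ
  have hDs : 0 < ‖D s‖ := norm_pos_iff.2 hD
  have hv' : 0 < ‖v‖ := norm_pos_iff.2 hv
  by_cases h0 : θ = 0
  · have : A' = 0 := IsLocalMin.hasDerivAt_eq_zero
      (Filter.Eventually.of_forall fun r => by
        simpa [← hθ, h0] using InnerProductGeometry.angle_nonneg v (D r)) hA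
    rw [this, abs_zero]; positivity
  by_cases hpi : θ = π
  · have : A' = 0 := IsLocalMax.hasDerivAt_eq_zero
      (Filter.Eventually.of_forall fun r => by
        simpa [← hθ, hpi] using InnerProductGeometry.angle_le_pi v (D r)) hA
    rw [this, abs_zero]; positivity
  have hsin : 0 < sin θ := sin_pos_of_pos_of_lt_pi
    (lt_of_le_of_ne (InnerProductGeometry.angle_nonneg _ _) (Ne.symm h0))
    (lt_of_le_of_ne (InnerProductGeometry.angle_le_pi _ _) hpi)
  have hN : HasDerivAt (fun r => ‖D r‖) (⟪D s, d⟫ / ‖D s‖) s := by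
    have h1 := hDd.norm_sq.sqrt (by positivity)
    simp only [Real.sqrt_sq (norm_nonneg _)] at h1
    convert h1 using 1
    field_simp
  have h1 : HasDerivAt (fun r => cos (InnerProductGeometry.angle v (D r)) * (‖v‖ * ‖D r‖))
      (-sin θ * A' * (‖v‖ * ‖D s‖) + cos θ * (‖v‖ * (⟪D s, d⟫ / ‖D s‖))) s :=
    hA.cos.mul (hN.const_mul ‖v‖)
  have h2 : HasDerivAt (fun r => ⟪v, D r⟫) ⟪v, d⟫ s := by
    simpa using (hasDerivAt_const s v).inner ℝ hDd
  simp only [InnerProductGeometry.cos_angle_mul_norm_mul_norm] at h1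
  have key := h1.unique h2
  have hinner : ⟪v, D s⟫ = cos θ * (‖v‖ * ‖D s‖) :=
    (InnerProductGeometry.cos_angle_mul_norm_mul_norm v (D s)).symm
  set N := ‖D s‖ with hNdef
  set P := ‖projPerp d (D s)‖ with hP
  have hPsq : P ^ 2 = N ^ 2 - ⟪d, D s⟫ ^ 2 := norm_projPerp_sq hd _
  have ha : ‖N ^ 2 • v - ⟪v, D s⟫ • D s‖ = N ^ 2 * ‖v‖ * sin θ := by
    apply (sq_eq_sq₀ (norm_nonneg _) (by positivity)).1
    rw [norm_sub_sq_real, norm_smul, norm_smul, real_inner_smul_left, real_inner_smul_right,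
      hinner, ← hNdef, mul_pow _ (sin θ), sin_sq]
    simp only [mul_pow, Real.norm_eq_abs, sq_abs]
    ring
  have hb : ‖N ^ 2 • d - ⟪d, D s⟫ • D s‖ = N * P := by
    apply (sq_eq_sq₀ (norm_nonneg _) (by positivity)).1
    rw [mul_pow N P, hPsq, norm_sub_sq_real, norm_smul, norm_smul, real_inner_smul_left,
      real_inner_smul_right, ← hNdef, hd]
    simp only [mul_pow, Real.norm_eq_abs, sq_abs]
    ring
  have hab : ⟪N ^ 2 • v - ⟪v, D s⟫ • D s, N ^ 2 • d - ⟪d, D s⟫ • D s⟫ =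
      -(N ^ 2 * (sin θ * A' * ‖v‖ * N ^ 3)) := by
    have hk : N ^ 2 * ⟪v, d⟫ = -(sin θ * A' * ‖v‖ * N ^ 3) + ⟪v, D s⟫ * ⟪D s, d⟫ := by
      rw [← key, hinner]
      field_simp
    simp only [inner_sub_left, inner_sub_right, real_inner_smul_left, real_inner_smul_right,
      real_inner_self_eq_norm_sq, ← hNdef]
    rw [real_inner_comm (D s) d]
    linear_combination N ^ 2 * hk
  have hcs := abs_real_inner_le_norm (N ^ 2 • v - ⟪v, D s⟫ • D s) (N ^ 2 • d - ⟪d, D s⟫ • D s)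
  rw [hab, ha, hb, abs_neg, abs_mul, abs_mul, abs_mul, abs_mul, abs_of_pos hsin,
    abs_of_pos (show 0 < N ^ 2 by positivity), abs_of_pos (show 0 < N ^ 3 by positivity),
    abs_of_pos hv'] at hcs
  rw [le_div_iff₀ (by positivity)]
  have hpos : 0 < N ^ 3 * ‖v‖ * sin θ := by positivity
  refine le_of_mul_le_mul_left ?_ hpos
  calc _ = N ^ 2 * (sin θ * |A'| * ‖v‖ * N ^ 3) := by ring
    _ ≤ _ := hcs
    _ = _ := by ring

end Angle

section ArcLoop

open Filter Topology InnerProductGeometry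

variable {E : Type*} [NormedAddCommGroup E] [InnerProductSpace ℝ E]

theorem continuousAt_angle_right {v x : E} (hv : v ≠ 0) (hx : x ≠ 0) :
    ContinuousAt (fun y => angle v y) x :=
  ContinuousAt.comp (f := fun y => (v, y)) (continuousAt_angle (x := (v, x)) hv hx) (by fun_prop)

/-- A simple closed curve of length one, parametrized by arc length on `ℝ/ℤ`. -/
structure IsArcLoop (γ : ℝ → E) : Prop where
  periodic : Function.Periodic γ 1
  lipschitz : LipschitzWith 1 γ
  inj : ∀ s t, γ s = γ t → ∃ k : ℤ, s - t = k
  speed : ∀ᵐ t, DifferentiableAt ℝ γ t ∧ ‖deriv γ t‖ = 1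

/-- The distance of `γ t` from the tangent line at `γ s`, divided by the squared distance of the
two points. -/
def tpKernel (γ : ℝ → E) (s t : ℝ) : ℝ :=
  ‖projPerp (deriv γ s) (γ t - γ s)‖ / ‖γ t - γ s‖ ^ 2

theorem tpKernel_nonneg (γ : ℝ → E) (s t : ℝ) : 0 ≤ tpKernel γ s t := by
  unfold tpKernel; positivity

/-- The tangent-point energy, for `p = 2` and `q = 1`, of the curve seen from the point `γ u`. -/
def tpFrom (γ : ℝ → E) (u : ℝ) : ℝ≥0∞ :=
  ∫⁻ s in Ioo u (u + 1), ENNReal.ofReal (tpKernel γ s u)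

namespace IsArcLoop

variable {γ : ℝ → E} {u : ℝ}

theorem sub_ne_zero (h : IsArcLoop γ) {s : ℝ} (hs : s ∈ Ioo u (u + 1)) : γ s - γ u ≠ 0 := by
  intro h0
  obtain ⟨k, hk⟩ := h.inj s u (_root_.sub_eq_zero.1 h0)
  have h1 : (0 : ℝ) < k := by rw [← hk]; linarith [hs.1]
  have h2 : (k : ℝ) < 1 := by rw [← hk]; linarith [hs.2]
  norm_cast at h1 h2
  omega

theorem continuous (h : IsArcLoop γ) : Continuous γ := h.lipschitz.continuous

theorem continuousOn_angle (h : IsArcLoop γ) {v : E} (hv : v ≠ 0) :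
    ContinuousOn (fun s => angle v (γ s - γ u)) (Ioo u (u + 1)) := fun s hs =>
  ((continuousAt_angle_right hv (h.sub_ne_zero hs)).comp
    (f := fun s => γ s - γ u) (by have := h.continuous; fun_prop)).continuousWithinAt

theorem exists_lipschitzOnWith_angle (h : IsArcLoop γ) (v : E) {a b : ℝ} (ha : u < a)
    (hb : b < u + 1) :
    ∃ K, LipschitzOnWith K (fun s => angle v (γ s - γ u)) (Icc a b) := by
  obtain ⟨δ, hδ, hle⟩ : ∃ δ > 0, ∀ s ∈ Icc a b, δ ≤ ‖γ s - γ u‖ := by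
    apply isCompact_Icc.exists_forall_le'
    · have := h.continuous; fun_prop
    · exact fun s hs => norm_pos_iff.2 (h.sub_ne_zero ⟨ha.trans_le hs.1, hs.2.trans_lt hb⟩)
  have hK : 0 ≤ π / (2 * δ) := by positivity
  refine ⟨⟨π / (2 * δ), hK⟩, LipschitzOnWith.of_dist_le_mul fun s hs t ht => ?_⟩
  have h1 := angle_le_mul_norm_sub hδ (hle s hs) (hle t ht)
  have h2 := angle_le_angle_add_angle v (γ s - γ u) (γ t - γ u)
  have h3 := angle_le_angle_add_angle v (γ t - γ u) (γ s - γ u)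
  rw [angle_comm (γ t - γ u)] at h3
  have h4 : ‖γ s - γ u - (γ t - γ u)‖ ≤ dist s t := by
    rw [sub_sub_sub_cancel_right, ← dist_eq_norm]
    simpa using h.lipschitz.dist_le_mul s t
  calc dist (angle v (γ s - γ u)) (angle v (γ t - γ u)) ≤ angle (γ s - γ u) (γ t - γ u) := by
        rw [Real.dist_eq, abs_le]; constructor <;> linarith
    _ ≤ _ := h1.trans (mul_le_mul_of_nonneg_left h4 hK)

theorem integral_deriv_angle (h : IsArcLoop γ) (v : E) {a b : ℝ} (ha : u < a) (hab : a ≤ b)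
    (hb : b < u + 1) :
    IntervalIntegrable (deriv fun s => angle v (γ s - γ u)) volume a b ∧
    ∫ s in a..b, deriv (fun s => angle v (γ s - γ u)) s =
      angle v (γ b - γ u) - angle v (γ a - γ u) := by
  obtain ⟨K, hK⟩ := h.exists_lipschitzOnWith_angle v ha hb
  rw [← uIcc_of_le hab] at hK
  have := hK.absolutelyContinuousOnInterval
  exact ⟨this.intervalIntegrable_deriv, this.integral_deriv_eq_sub⟩

theorem ofReal_abs_angle_sub_le (h : IsArcLoop γ) {v : E} (hv : v ≠ 0) {a b : ℝ}
    (ha : u < a) (hab : a ≤ b) (hb : b < u + 1) :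
    ENNReal.ofReal |angle v (γ b - γ u) - angle v (γ a - γ u)| ≤
      ∫⁻ s in Ioc a b, ENNReal.ofReal (tpKernel γ s u) := by
  rw [← (h.integral_deriv_angle v ha hab hb).2, integral_of_le hab, ← Real.norm_eq_abs,
    ofReal_norm]
  refine (enorm_integral_le_lintegral_enorm _).trans ?_
  refine lintegral_mono_ae ?_
  filter_upwards [ae_restrict_of_ae h.speed, ae_restrict_mem measurableSet_Ioc] with s hs hmem
  rw [← ofReal_norm]
  refine ENNReal.ofReal_le_ofReal ?_
  by_cases hd : DifferentiableAt ℝ (fun s => angle v (γ s - γ u)) s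
  · have := abs_deriv_angle_le (D := fun s => γ s - γ u) hv
      (h.sub_ne_zero ⟨ha.trans hmem.1, hmem.2.trans_lt hb⟩) hs.2
      (hs.1.hasDerivAt.sub_const _) hd.hasDerivAt
    rw [Real.norm_eq_abs]
    refine this.trans (le_of_eq ?_)
    rw [tpKernel, ← neg_sub (γ s) (γ u), norm_projPerp_neg, norm_neg]
  · rw [deriv_zero_of_not_differentiableAt hd, norm_zero]
    exact tpKernel_nonneg _ _ _

theorem tendsto_angle_left {e : E} (he : ‖e‖ = 1) (hd : HasDerivAt γ e u) :
    Tendsto (fun s => angle e (γ s - γ u)) (𝓝[>] u) (𝓝 0) := by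
  have he0 : e ≠ 0 := by rintro rfl; simp at he
  have h1 : Tendsto (fun s => angle e (slope γ u s)) (𝓝[>] u) (𝓝 (angle e e)) := by
    have h2 : Tendsto (slope γ u) (𝓝[>] u) (𝓝 e) :=
      (hasDerivAt_iff_tendsto_slope.1 hd).mono_left
        (nhdsWithin_mono _ fun _ hx => ne_of_gt hx)
    exact (continuousAt_angle_right he0 he0).tendsto.comp h2
  rw [angle_self he0] at h1
  refine h1.congr' ?_
  filter_upwards [self_mem_nhdsWithin] with s hs
  have : 0 < (s - u)⁻¹ := inv_pos.2 (sub_pos.2 hs)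
  rw [slope_def_module, angle_smul_right_of_pos _ _ this]

theorem tendsto_angle_right (h : IsArcLoop γ) {e : E} (he : ‖e‖ = 1) (hd : HasDerivAt γ e u) :
    Tendsto (fun s => angle e (γ s - γ u)) (𝓝[<] (u + 1)) (𝓝 π) := by
  have he0 : e ≠ 0 := by rintro rfl; simp at he
  have hd' : HasDerivAt γ e (u + 1) := by
    have : HasDerivAt (fun s => γ (s - 1)) e (u + 1) :=
      HasDerivAt.comp_sub_const (u + 1) 1 (by simpa using hd)
    rwa [show (fun s => γ (s - 1)) = γ from funext h.periodic.sub_eq] at this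
  have h1 : Tendsto (fun s => angle e (-slope γ (u + 1) s)) (𝓝[<] (u + 1)) (𝓝 (angle e (-e))) := by
    have h2 : Tendsto (fun s => (-slope γ (u + 1) s)) (𝓝[<] (u + 1)) (𝓝 (-e)) :=
      ((hasDerivAt_iff_tendsto_slope.1 hd').mono_left
        (nhdsWithin_mono _ fun _ hx => ne_of_lt hx)).neg
    exact (continuousAt_angle_right he0 (neg_ne_zero.2 he0)).tendsto.comp h2
  rw [angle_self_neg_of_nonzero he0] at h1
  refine h1.congr' ?_
  filter_upwards [self_mem_nhdsWithin] with s hs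
  have : 0 < (u + 1 - s)⁻¹ := inv_pos.2 (sub_pos.2 hs)
  rw [slope_def_module, ← neg_smul, ← inv_neg, neg_sub, angle_smul_right_of_pos _ _ this,
    h.periodic]

theorem ofReal_angle_le (h : IsArcLoop γ) {e : E} (he : ‖e‖ = 1) (hd : HasDerivAt γ e u)
    {b : ℝ} (hb : b ∈ Ioo u (u + 1)) :
    ENNReal.ofReal (angle e (γ b - γ u)) ≤
      ∫⁻ s in Ioc u b, ENNReal.ofReal (tpKernel γ s u) := by
  have he0 : e ≠ 0 := by rintro rfl; simp at he
  have h1 : Tendsto (fun a => ENNReal.ofReal |angle e (γ b - γ u) - angle e (γ a - γ u)|)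
      (𝓝[>] u) (𝓝 (ENNReal.ofReal |angle e (γ b - γ u) - 0|)) :=
    ENNReal.tendsto_ofReal ((tendsto_const_nhds.sub (tendsto_angle_left he hd)).abs)
  rw [sub_zero, abs_of_nonneg (angle_nonneg _ _)] at h1
  refine le_of_tendsto h1 ?_
  filter_upwards [Ioo_mem_nhdsGT hb.1] with a ha
  exact (h.ofReal_abs_angle_sub_le he0 ha.1 ha.2.le hb.2).trans
    (lintegral_mono_set (Ioc_subset_Ioc_left ha.1.le))

theorem ofReal_pi_sub_angle_le (h : IsArcLoop γ) {e : E} (he : ‖e‖ = 1) (hd : HasDerivAt γ e u)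
    {a : ℝ} (ha : a ∈ Ioo u (u + 1)) :
    ENNReal.ofReal (π - angle e (γ a - γ u)) ≤
      ∫⁻ s in Ioo a (u + 1), ENNReal.ofReal (tpKernel γ s u) := by
  have he0 : e ≠ 0 := by rintro rfl; simp at he
  have h1 : Tendsto (fun b => ENNReal.ofReal |angle e (γ b - γ u) - angle e (γ a - γ u)|)
      (𝓝[<] (u + 1)) (𝓝 (ENNReal.ofReal |π - angle e (γ a - γ u)|)) :=
    ENNReal.tendsto_ofReal (((h.tendsto_angle_right he hd).sub tendsto_const_nhds).abs)
  rw [abs_of_nonneg (sub_nonneg.2 (angle_le_pi _ _))] at h1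
  refine le_of_tendsto h1 ?_
  filter_upwards [Ioo_mem_nhdsLT ha.2] with b hb
  exact (h.ofReal_abs_angle_sub_le he0 ha.1 hb.1.le hb.2).trans
    (lintegral_mono_set fun s hs => ⟨hs.1, hs.2.trans_lt hb.2⟩)

theorem ofReal_angle_add_le_tpFrom (h : IsArcLoop γ) {e : E} (he : ‖e‖ = 1)
    (hd : HasDerivAt γ e u) {a b : ℝ} (ha : u < a) (hab : a ≤ b) (hb : b < u + 1) :
    ENNReal.ofReal (angle e (γ a - γ u) + angle (γ a - γ u) (γ b - γ u) +
      (π - angle e (γ b - γ u))) ≤ tpFrom γ u := by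
  have h0 : γ a - γ u ≠ 0 := h.sub_ne_zero ⟨ha, hab.trans_lt hb⟩
  have h1 := h.ofReal_angle_le he hd ⟨ha, hab.trans_lt hb⟩
  have h2 := h.ofReal_abs_angle_sub_le h0 ha hab hb
  have h3 := h.ofReal_pi_sub_angle_le he hd ⟨ha.trans_le hab, hb⟩
  rw [angle_self h0, sub_zero, abs_of_nonneg (angle_nonneg _ _)] at h2
  rw [ENNReal.ofReal_add (add_nonneg (angle_nonneg _ _) (angle_nonneg _ _))
    (sub_nonneg.2 (angle_le_pi _ _)), ENNReal.ofReal_add (angle_nonneg _ _) (angle_nonneg _ _)]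
  refine (add_le_add (add_le_add h1 h2) h3).trans_eq ?_
  rw [tpFrom, ← lintegral_union measurableSet_Ioc (Ioc_disjoint_Ioc_of_le le_rfl),
    Ioc_union_Ioc_eq_Ioc ha.le hab, ← lintegral_union measurableSet_Ioo,
    Ioc_union_Ioo_eq_Ioo (ha.trans_le hab).le hb]
  exact Set.disjoint_left.2 fun x hx hx' => hx'.1.not_ge hx.2

theorem pi_le_tpFrom (h : IsArcLoop γ) {e : E} (he : ‖e‖ = 1) (hd : HasDerivAt γ e u) :
    ENNReal.ofReal π ≤ tpFrom γ u := by
  have hmem : u + 1 / 2 ∈ Ioo u (u + 1) := ⟨by linarith, by linarith⟩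
  have := h.ofReal_angle_add_le_tpFrom he hd hmem.1 le_rfl hmem.2
  rwa [angle_self (h.sub_ne_zero hmem), add_zero, add_sub_cancel] at this

end IsArcLoop

end ArcLoop

section HalfPlane

open Filter Topology InnerProductGeometry

variable {E : Type*} [NormedAddCommGroup E] [InnerProductSpace ℝ E]

theorem eq_inner_smul_add_inner_smul {e m x : E} (he : ‖e‖ = 1) (hm : ‖m‖ = 1) (hem : ⟪e, m⟫ = 0)
    (hx : ‖x‖ ^ 2 = ⟪e, x⟫ ^ 2 + ⟪m, x⟫ ^ 2) : x = ⟪e, x⟫ • e + ⟪m, x⟫ • m := by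
  have hme : ⟪m, e⟫ = 0 := by rw [real_inner_comm]; exact hem
  rw [← sub_eq_zero, ← norm_eq_zero, ← sq_eq_zero_iff, ← real_inner_self_eq_norm_sq]
  simp only [inner_sub_left, inner_sub_right, inner_add_left, inner_add_right,
    real_inner_smul_left, real_inner_smul_right, real_inner_self_eq_norm_sq e, real_inner_self_eq_norm_sq m,
    real_inner_self_eq_norm_sq x, he, hm, hem, hme, hx, real_inner_comm e x, real_inner_comm m x]
  ring

/-- The curve lies in the half-plane bounded by the line through `γ u` in direction `e`, on the side
of the unit normal `m`. -/
structure LiesInHalfPlane (γ : ℝ → E) (u : ℝ) (e m : E) : Prop where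
  norm_left : ‖e‖ = 1
  norm_right : ‖m‖ = 1
  inner_eq_zero : ⟪e, m⟫ = 0
  eq_smul_add_smul : ∀ s, γ s - γ u = ⟪e, γ s - γ u⟫ • e + ⟪m, γ s - γ u⟫ • m
  nonneg : ∀ s, 0 ≤ ⟪m, γ s - γ u⟫

namespace LiesInHalfPlane

variable {γ : ℝ → E} {u : ℝ} {e m : E}

theorem norm_sq_eq (hp : LiesInHalfPlane γ u e m) (s : ℝ) :
    ‖γ s - γ u‖ ^ 2 = ⟪e, γ s - γ u⟫ ^ 2 + ⟪m, γ s - γ u⟫ ^ 2 := by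
  rw [← real_inner_self_eq_norm_sq]
  nth_rw 1 [hp.eq_smul_add_smul s]
  rw [inner_add_left, real_inner_smul_left, real_inner_smul_left]
  ring

theorem inner_left_eq (hp : LiesInHalfPlane γ u e m) (s : ℝ) :
    ⟪e, γ s - γ u⟫ = cos (angle e (γ s - γ u)) * ‖γ s - γ u‖ := by
  rw [← cos_angle_mul_norm_mul_norm, hp.norm_left, one_mul]

theorem inner_right_eq (hp : LiesInHalfPlane γ u e m) (s : ℝ) :
    ⟪m, γ s - γ u⟫ = sin (angle e (γ s - γ u)) * ‖γ s - γ u‖ := by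
  apply (sq_eq_sq₀ (hp.nonneg s) (mul_nonneg (sin_angle_nonneg _ _) (norm_nonneg _))).1
  have h1 := hp.norm_sq_eq s
  rw [hp.inner_left_eq s] at h1
  rw [mul_pow, sin_sq]
  linear_combination -h1

end LiesInHalfPlane

namespace IsArcLoop

variable {γ : ℝ → E} {u : ℝ}

theorem exists_mem_Ico_eq (h : IsArcLoop γ) (u s : ℝ) : ∃ t ∈ Ico u (u + 1), γ t = γ s := by
  obtain ⟨t, ht, hts⟩ := h.periodic.exists_mem_Ico one_pos s u
  exact ⟨t, ht, hts.symm⟩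

theorem exists_angle_eq (h : IsArcLoop γ) {e : E} (he : ‖e‖ = 1) (hd : HasDerivAt γ e u)
    {b α : ℝ} (hb : b ∈ Ioo u (u + 1)) (hα : 0 < α) (hαb : α < angle e (γ b - γ u)) :
    ∃ a ∈ Ioo u b, angle e (γ a - γ u) = α := by
  have he0 : e ≠ 0 := by rintro rfl; simp at he
  obtain ⟨a, ha, hab⟩ := (((tendsto_angle_left he hd).eventually_lt_const hα).and
    (Ioo_mem_nhdsGT hb.1)).exists
  obtain ⟨c, hc, hcα⟩ := intermediate_value_Ioo hab.2.le ((h.continuousOn_angle he0).mono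
    (Icc_subset_Ioo hab.1 hb.2)) ⟨ha, hαb⟩
  exact ⟨c, ⟨hab.1.trans hc.1, hc.2⟩, hcα⟩

theorem exists_liesInHalfPlane (h : IsArcLoop γ) {e : E} (he : ‖e‖ = 1) (hd : HasDerivAt γ e u)
    (heq : tpFrom γ u ≤ ENNReal.ofReal π) :
    ∃ m, LiesInHalfPlane γ u e m ∧ ∃ (c : ℝ) (r : ℝ), m = r • (γ c - γ u) := by
  obtain ⟨b, hb, hbmem⟩ := (((h.tendsto_angle_right he hd).eventually_const_lt
    (show π / 2 < π by linarith [pi_pos])).and (Ioo_mem_nhdsLT (show u < u + 1 by linarith))).exists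
  obtain ⟨c, hc, hcA⟩ := h.exists_angle_eq he hd hbmem (by positivity) hb
  have hcmem : c ∈ Ioo u (u + 1) := ⟨hc.1, hc.2.trans hbmem.2⟩
  have hc0 := h.sub_ne_zero hcmem
  set m := ‖γ c - γ u‖⁻¹ • (γ c - γ u) with hm
  have hm1 : ‖m‖ = 1 := norm_smul_inv_norm hc0
  have hposc : 0 < ‖γ c - γ u‖⁻¹ := inv_pos.2 (norm_pos_iff.2 hc0)
  have hem : ⟪e, m⟫ = 0 := by
    rw [inner_eq_zero_iff_angle_eq_pi_div_two, hm, angle_smul_right_of_pos _ _ hposc, hcA]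
  have hadd {s t : ℝ} (hs : u < s) (hst : s ≤ t) (ht : t < u + 1) :
      angle e (γ s - γ u) + angle (γ s - γ u) (γ t - γ u) = angle e (γ t - γ u) := by
    have h1 := (h.ofReal_angle_add_le_tpFrom he hd hs hst ht).trans heq
    rw [ENNReal.ofReal_le_ofReal_iff pi_pos.le] at h1
    have h2 := angle_le_angle_add_angle e (γ s - γ u) (γ t - γ u)
    linarith
  have hinner {s : ℝ} (hs : s ∈ Ioo u (u + 1)) :
      ⟪m, γ s - γ u⟫ = sin (angle e (γ s - γ u)) * ‖γ s - γ u‖ := by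
    rw [← cos_angle_mul_norm_mul_norm, hm1, one_mul, hm, angle_smul_left_of_pos _ _ hposc]
    congr 1
    rcases le_total s c with hsc | hsc
    · have := hadd hs.1 hsc hcmem.2
      rw [angle_comm, ← cos_pi_div_two_sub, ← hcA, ← this, add_sub_cancel_left]
    · have := hadd hcmem.1 hsc hs.2
      rw [← this, hcA, add_comm (π / 2), sin_add_pi_div_two]
  have hIco {s : ℝ} (hs : s ∈ Ico u (u + 1)) :
      γ s - γ u = ⟪e, γ s - γ u⟫ • e + ⟪m, γ s - γ u⟫ • m ∧ 0 ≤ ⟪m, γ s - γ u⟫ := by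
    rcases hs.1.eq_or_lt with rfl | hus
    · simp
    · have hs' : s ∈ Ioo u (u + 1) := ⟨hus, hs.2⟩
      refine ⟨eq_inner_smul_add_inner_smul he hm1 hem ?_, ?_⟩
      · rw [hinner hs', ← cos_angle_mul_norm_mul_norm, he, one_mul, mul_pow, mul_pow, sin_sq]
        ring
      · rw [hinner hs']
        exact mul_nonneg (sin_angle_nonneg _ _) (norm_nonneg _)
  refine ⟨m, ⟨he, hm1, hem, fun s => ?_, fun s => ?_⟩, c, _, hm⟩
  · obtain ⟨t, ht, hts⟩ := h.exists_mem_Ico_eq u s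
    exact hts ▸ (hIco ht).1
  · obtain ⟨t, ht, hts⟩ := h.exists_mem_Ico_eq u s
    exact hts ▸ (hIco ht).2

theorem monotoneOn_angle (h : IsArcLoop γ) {e : E} (he : ‖e‖ = 1) (hd : HasDerivAt γ e u)
    (hinj : ∀ s ∈ Ioo u (u + 1), ∀ t ∈ Ioo u (u + 1), angle e (γ s - γ u) = angle e (γ t - γ u) →
      0 < angle e (γ s - γ u) → angle e (γ s - γ u) < π → s = t) :
    MonotoneOn (fun s => angle e (γ s - γ u)) (Ioo u (u + 1)) := by
  have he0 : e ≠ 0 := by rintro rfl; simp at he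
  intro s hs t ht hst
  by_contra! hlt
  obtain ⟨α, hα⟩ := exists_between hlt
  have hα0 : 0 < α := (angle_nonneg _ _).trans_lt hα.1
  have hαpi : α < π := hα.2.trans_le (angle_le_pi _ _)
  obtain ⟨a, ha, haα⟩ := h.exists_angle_eq he hd hs hα0 hα.2
  obtain ⟨b, hb, hbα⟩ := intermediate_value_Ioo' hst ((h.continuousOn_angle (u := u) he0).mono
    (Icc_subset_Ioo hs.1 ht.2)) hα
  have hab := hinj a ⟨ha.1, ha.2.trans hs.2⟩ b ⟨hs.1.trans hb.1, hb.2.trans ht.2⟩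
    (haα.trans hbα.symm) (haα ▸ hα0) (haα ▸ hαpi)
  exact absurd (ha.2.trans hb.1) (hab ▸ lt_irrefl a)

theorem tpKernel_eq_of_liesInHalfPlane (h : IsArcLoop γ) {e m : E} (hp : LiesInHalfPlane γ u e m)
    {s A' : ℝ} (hs : s ∈ Ioo u (u + 1)) (hγ : DifferentiableAt ℝ γ s) (hγ1 : ‖deriv γ s‖ = 1)
    (hA : HasDerivAt (fun s => angle e (γ s - γ u)) A' s) (hA0 : 0 ≤ A') :
    tpKernel γ s u = A' := by
  set N := ‖γ s - γ u‖ with hN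
  have hNpos : 0 < N := norm_pos_iff.2 (h.sub_ne_zero hs)
  have hΔ : HasDerivAt (fun s => γ s - γ u) (deriv γ s) s := hγ.hasDerivAt.sub_const _
  have hx : HasDerivAt (fun s => ⟪e, γ s - γ u⟫) ⟪e, deriv γ s⟫ s := by
    simpa using (hasDerivAt_const s e).inner ℝ hΔ
  have hy : HasDerivAt (fun s => ⟪m, γ s - γ u⟫) ⟪m, deriv γ s⟫ s := by
    simpa using (hasDerivAt_const s m).inner ℝ hΔ
  have hdec : deriv γ s = ⟪e, deriv γ s⟫ • e + ⟪m, deriv γ s⟫ • m := by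
    refine hΔ.unique ?_
    rw [show (fun s => γ s - γ u) = _ from funext hp.eq_smul_add_smul]
    exact (hx.smul_const e).add (hy.smul_const m)
  set x' := ⟪e, deriv γ s⟫ with hx'
  set y' := ⟪m, deriv γ s⟫ with hy'
  have hnorm : x' ^ 2 + y' ^ 2 = 1 := by
    have h1 : ⟪deriv γ s, deriv γ s⟫ = 1 := by rw [real_inner_self_eq_norm_sq, hγ1, one_pow]
    nth_rw 1 [hdec] at h1
    rw [inner_add_left, real_inner_smul_left, real_inner_smul_left, ← hx', ← hy'] at h1
    linear_combination h1
  have hinner : ⟪deriv γ s, γ s - γ u⟫ = x' * ⟪e, γ s - γ u⟫ + y' * ⟪m, γ s - γ u⟫ := by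
    nth_rw 1 [hdec]
    rw [inner_add_left, real_inner_smul_left, real_inner_smul_left]
  have h1 : HasDerivAt (fun s => ⟪m, γ s - γ u⟫ * cos (angle e (γ s - γ u)) -
      ⟪e, γ s - γ u⟫ * sin (angle e (γ s - γ u))) _ s := (hy.mul hA.cos).sub (hx.mul hA.sin)
  have h2 : (fun s => ⟪m, γ s - γ u⟫ * cos (angle e (γ s - γ u)) -
      ⟪e, γ s - γ u⟫ * sin (angle e (γ s - γ u))) = fun _ => 0 := by
    funext r
    rw [hp.inner_left_eq, hp.inner_right_eq]
    ring
  rw [h2] at h1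
  have h3 := h1.unique (hasDerivAt_const s 0)
  have hX := hp.inner_left_eq s
  have hY := hp.inner_right_eq s
  rw [← hN] at hX hY
  have hcs := sin_sq_add_cos_sq (angle e (γ s - γ u))
  set θ := angle e (γ s - γ u)
  rw [hX, hY] at h3
  have hP : ‖projPerp (deriv γ s) (γ s - γ u)‖ = N ^ 2 * A' := by
    apply (sq_eq_sq₀ (norm_nonneg _) (by positivity)).1
    have h4 : N * A' = y' * cos θ - x' * sin θ := by linear_combination -h3 - N * A' * hcs
    rw [norm_projPerp_sq hγ1, hinner, hX, hY, ← hN,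
      show (N ^ 2 * A') ^ 2 = N ^ 2 * (N * A') ^ 2 by ring, h4]
    linear_combination (-N ^ 2 * (sin θ ^ 2 + cos θ ^ 2)) * hnorm + (-N ^ 2) * hcs
  rw [tpKernel, ← neg_sub (γ s) (γ u), norm_projPerp_neg, norm_neg, hP, ← hN]
  field_simp

theorem tpFrom_le_pi (h : IsArcLoop γ) {e m : E} (hp : LiesInHalfPlane γ u e m)
    (hmono : MonotoneOn (fun s => angle e (γ s - γ u)) (Ioo u (u + 1))) :
    tpFrom γ u ≤ ENNReal.ofReal π := by
  have key {a b : ℝ} (ha : u < a) (hab : a ≤ b) (hb : b < u + 1) :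
      ∫⁻ s in Ioc a b, ENNReal.ofReal (tpKernel γ s u) ≤ ENNReal.ofReal π := by
    have hsub : Ioc a b ⊆ Ioo u (u + 1) := fun s hs => ⟨ha.trans hs.1, hs.2.trans_lt hb⟩
    have hpos : ∀ s ∈ Ioc a b, 0 ≤ deriv (fun s => angle e (γ s - γ u)) s := fun s hs => by
      rw [← derivWithin_of_mem_nhds (isOpen_Ioo.mem_nhds (hsub hs))]
      exact hmono.derivWithin_nonneg
    obtain ⟨hIntg, heq⟩ := h.integral_deriv_angle e ha hab hb
    obtain ⟨K, hK⟩ := h.exists_lipschitzOnWith_angle e ha hb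
    rw [← uIcc_of_le hab] at hK
    have hdiff := hK.absolutelyContinuousOnInterval.ae_differentiableAt
    calc ∫⁻ s in Ioc a b, ENNReal.ofReal (tpKernel γ s u)
        = ∫⁻ s in Ioc a b, ENNReal.ofReal (deriv (fun s => angle e (γ s - γ u)) s) := by
          refine lintegral_congr_ae ?_
          filter_upwards [ae_restrict_of_ae h.speed, ae_restrict_of_ae hdiff,
            ae_restrict_mem measurableSet_Ioc] with s hs hs' hmem
          rw [h.tpKernel_eq_of_liesInHalfPlane hp (hsub hmem) hs.1 hs.2
            (hs' (by rw [uIcc_of_le hab]; exact Ioc_subset_Icc_self hmem)).hasDerivAt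
            (hpos s hmem)]
      _ = ENNReal.ofReal (angle e (γ b - γ u) - angle e (γ a - γ u)) := by
          rw [← heq, integral_of_le hab, ofReal_integral_eq_lintegral_ofReal hIntg.1]
          exact (ae_restrict_mem measurableSet_Ioc).mono hpos
      _ ≤ ENNReal.ofReal π := ENNReal.ofReal_le_ofReal
          (by linarith [angle_nonneg e (γ a - γ u), angle_le_pi e (γ b - γ u)])
  obtain ⟨a, b, ha, hb, hamem, hbmem, hab, hau, hbu⟩ :=
    exists_seq_strictAnti_strictMono_tendsto (show u < u + 1 by linarith)
  have hU : Ioo u (u + 1) = ⋃ n, Ioc (a n) (b n) := by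
    refine Subset.antisymm (fun s hs => ?_)
      (iUnion_subset fun n s hs => ⟨(hamem n).1.trans hs.1, hs.2.trans_lt (hbmem n).2⟩)
    obtain ⟨n, hn⟩ := ((hau.eventually_lt_const hs.1).and (hbu.eventually_const_lt hs.2)).exists
    exact mem_iUnion.2 ⟨n, hn.1, hn.2.le⟩
  rw [tpFrom, hU, setLIntegral_iUnion_of_directed]
  · exact iSup_le fun n => key (hamem n).1 (hab n n).le (hbmem n).2
  · exact directed_of_isDirected_le fun i j hij =>
      Ioc_subset_Ioc (ha.antitone hij) (hb.monotone hij)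

end IsArcLoop

end HalfPlane

section PlaneConvex

variable {E : Type*} [NormedAddCommGroup E] [InnerProductSpace ℝ E] [FiniteDimensional ℝ E]

/-- A nonempty convex set, seen inside the direction of its affine span. -/
theorem Convex.exists_image_direction {K : Set E} (hK : Convex ℝ K) (hne : K.Nonempty) :
    ∃ (p : E) (K' : Set (affineSpan ℝ K).direction), Convex ℝ K' ∧ (interior K').Nonempty ∧
      K = (fun v : (affineSpan ℝ K).direction => (v : E) + p) '' K' ∧
      intrinsicInterior ℝ K = (fun v : (affineSpan ℝ K).direction => (v : E) + p) '' interior K' ∧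
      intrinsicFrontier ℝ K = (fun v : (affineSpan ℝ K).direction => (v : E) + p) '' frontier K' := by
  have hIntg := hne.intrinsicInterior hK
  have := hne.coe_sort
  obtain ⟨p, hp⟩ := hne
  let p' : affineSpan ℝ K := ⟨p, subset_affineSpan _ _ hp⟩
  let φ : (affineSpan ℝ K).direction ≃ₜ affineSpan ℝ K :=
    (AffineIsometryEquiv.vaddConst ℝ p').toHomeomorph
  have hφ (v) : (φ v : E) = v + p := rfl
  have himg (S : Set (affineSpan ℝ K)) :
      ((↑) : affineSpan ℝ K → E) '' S = (fun v : (affineSpan ℝ K).direction => (v : E) + p) '' (φ ⁻¹' S) := by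
    rw [← φ.image_symm, ← image_comp]
    refine image_congr fun x _ => ?_
    rw [Function.comp_apply, ← hφ, φ.apply_symm_apply]
  have hI : intrinsicInterior ℝ K = (fun v : (affineSpan ℝ K).direction => (v : E) + p) '' interior (φ ⁻¹' ((↑) ⁻¹' K)) := by
    rw [intrinsicInterior, himg, φ.preimage_interior]
  refine ⟨p, φ ⁻¹' ((↑) ⁻¹' K), ?_, ?_, ?_, hI, ?_⟩
  · intro v hv w hw a b ha hb hab
    change ((a • v + b • w : (affineSpan ℝ K).direction) : E) + p ∈ K
    have h1 : (v : E) + p ∈ K := hv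
    have h2 : (w : E) + p ∈ K := hw
    convert hK h1 h2 ha hb hab using 1
    push_cast
    rw [smul_add, smul_add, add_add_add_comm, ← add_smul, hab, one_smul]
  · rw [hI] at hIntg
    exact hIntg.of_image
  · rw [← himg]
    exact (Subtype.image_preimage_coe (affineSpan ℝ K : Set E) K).trans
      (inter_eq_right.2 (subset_affineSpan ℝ K)) |>.symm
  · rw [intrinsicFrontier, himg, φ.preimage_frontier]

/-- Supporting hyperplanes at points of the intrinsic frontier. -/
theorem Convex.exists_inner_nonneg {K : Set E} (hK : Convex ℝ K) {x : E}
    (hx : x ∈ intrinsicFrontier ℝ K) :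
    ∃ ν ∈ (affineSpan ℝ K).direction, ν ≠ 0 ∧ (∀ y ∈ K, 0 ≤ ⟪ν, y - x⟫) ∧
      ∀ y ∈ intrinsicFrontier ℝ K, 0 ≤ ⟪ν, y - x⟫ := by
  have hne : K.Nonempty := by
    rw [nonempty_iff_ne_empty]
    rintro rfl
    simp at hx
  obtain ⟨p, K', hK', hIntg, hKe, -, hfr⟩ := hK.exists_image_direction hne
  rw [hfr] at hx
  obtain ⟨z, hz, rfl⟩ := hx
  obtain ⟨f, hf⟩ := geometric_hahn_banach_open_point hK'.interior isOpen_interior hz.2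
  have hcl : ∀ y ∈ closure K', f y ≤ f z := by
    rw [← hK'.closure_interior_eq_closure_of_nonempty_interior hIntg]
    exact fun y hy => closure_minimal (fun a ha => (hf a ha).le)
      (isClosed_le f.continuous continuous_const) hy
  set ν := -(InnerProductSpace.toDual ℝ _).symm f with hν
  have hνf (y : (affineSpan ℝ K).direction) : ⟪(ν : E), (y : E) + p - (z + p)⟫ = f z - f y := by
    rw [add_sub_add_right_eq_sub, ← Submodule.coe_sub, ← Submodule.coe_inner, hν, inner_neg_left,
      InnerProductSpace.toDual_symm_apply, map_sub]
    ring
  refine ⟨ν, ν.2, fun h0 => ?_, fun y hy => ?_, fun y hy => ?_⟩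
  · obtain ⟨a, ha⟩ := hIntg
    have := hνf a
    rw [h0, inner_zero_left] at this
    linarith [hf a ha]
  · rw [hKe] at hy
    obtain ⟨w, hw, rfl⟩ := hy
    rw [hνf]
    linarith [hcl w (subset_closure hw)]
  · rw [hfr] at hy
    obtain ⟨w, hw, rfl⟩ := hy
    rw [hνf]
    linarith [hcl w hw.1]

theorem Convex.mem_intrinsicFrontier_of_inner_nonneg {K : Set E} (hK : Convex ℝ K) {x ν : E}
    (hx : x ∈ K) (hν : ν ∈ (affineSpan ℝ K).direction) (hν0 : ν ≠ 0)
    (h : ∀ y ∈ K, 0 ≤ ⟪ν, y - x⟫) : x ∈ intrinsicFrontier ℝ K := by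
  have hcl := subset_intrinsicClosure (𝕜 := ℝ) hx
  rw [← intrinsicInterior_union_intrinsicFrontier] at hcl
  refine hcl.resolve_left fun hIntg => ?_
  obtain ⟨p, K', hK', -, hKe, hI, -⟩ := hK.exists_image_direction ⟨x, hx⟩
  rw [hI] at hIntg
  obtain ⟨z, hz, rfl⟩ := hIntg
  have hc : ContinuousAt (fun t : ℝ => z - t • (⟨ν, hν⟩ : (affineSpan ℝ K).direction)) 0 := by
    fun_prop
  have hev := (hc.eventually_mem (by simpa using isOpen_interior.mem_nhds hz)).filter_mono
    (nhdsWithin_le_nhds (s := Ioi 0))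
  obtain ⟨t, ht, htpos⟩ := (hev.and self_mem_nhdsWithin).exists
  have htpos' : (0 : ℝ) < t := htpos
  have h1 := h _ (hKe.ge (mem_image_of_mem _ ht))
  have h2 : ((z - t • (⟨ν, hν⟩ : (affineSpan ℝ K).direction) : (affineSpan ℝ K).direction) : E) + p
      - (z + p) = -(t • ν) := by
    push_cast; abel
  rw [h2, inner_neg_right, real_inner_smul_right, real_inner_self_eq_norm_sq] at h1
  have : 0 < t * ‖ν‖ ^ 2 := mul_pos htpos' (pow_pos (norm_pos_iff.2 hν0) 2)
  linarith

/-- A ray from an interior point meets the frontier of a convex set at most once. -/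
theorem Convex.eq_of_mem_frontier_of_sub_eq_smul {F : Type*} [NormedAddCommGroup F]
    [NormedSpace ℝ F] {K : Set F} (hK : Convex ℝ K) {c x y : F} {r : ℝ} (hc : c ∈ interior K)
    (hx : x ∈ frontier K) (hy : y ∈ frontier K) (hr : 0 < r) (h : x - c = r • (y - c)) : x = y := by
  have key {x y : F} {r : ℝ} (hx : x ∈ frontier K) (hy : y ∈ frontier K) (hr : 0 < r) (hr1 : r < 1)
      (h : x - c = r • (y - c)) : False := by
    refine hx.2 (hK.openSegment_interior_closure_subset_interior hc hy.1
      ⟨1 - r, r, by linarith, hr, by ring, ?_⟩)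
    rw [← sub_add_cancel x c, h, smul_sub, sub_smul, one_smul]
    abel
  rcases lt_trichotomy r 1 with hr1 | rfl | hr1
  · exact (key hx hy hr hr1 h).elim
  · simpa using h
  · refine (key hy hx (inv_pos.2 hr) (inv_lt_one_of_one_lt₀ hr1) ?_).elim
    rw [h, inv_smul_smul₀ hr.ne']

theorem exists_unit_orthogonal {F : Type*} [NormedAddCommGroup F] [InnerProductSpace ℝ F]
    (hF : Module.finrank ℝ F = 2) {a : F} (ha : ‖a‖ = 1) :
    ∃ b : F, ‖b‖ = 1 ∧ ⟪a, b⟫ = 0 := by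
  have : Fact (Module.finrank ℝ F = 1 + 1) := ⟨hF⟩
  have ha0 : a ≠ 0 := by rintro rfl; simp at ha
  have h1 := Submodule.finrank_orthogonal_span_singleton (𝕜 := ℝ) (n := 1) ha0
  have : Nontrivial (ℝ ∙ a)ᗮ := Module.nontrivial_of_finrank_pos (R := ℝ) (by omega)
  obtain ⟨b, hb⟩ := exists_norm_eq (ℝ ∙ a)ᗮ zero_le_one
  exact ⟨b, hb, Submodule.mem_orthogonal_singleton_iff_inner_right.1 b.2⟩

theorem eq_smul_add_smul_of_finrank_eq_two {F : Type*} [NormedAddCommGroup F]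
    [InnerProductSpace ℝ F] (hF : Module.finrank ℝ F = 2) {a b : F} (ha : ‖a‖ = 1) (hb : ‖b‖ = 1)
    (hab : ⟪a, b⟫ = 0) (x : F) : x = ⟪a, x⟫ • a + ⟪b, x⟫ • b := by
  have : FiniteDimensional ℝ F := Module.finite_of_finrank_pos (by omega)
  have hon : Orthonormal ℝ ![a, b] := by
    simp [orthonormal_vecCons_iff, ha, hb, hab]
  have hspan := hon.linearIndependent.span_eq_top_of_card_eq_finrank (by simp [hF])
  let B := OrthonormalBasis.mk hon hspan.ge
  have := B.sum_repr' x
  simpa [B, Fin.sum_univ_two] using this.symm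

/-- A simple closed curve contained in the frontier of a planar convex set covers it. -/
theorem Convex.range_eq_frontier {F : Type*} [NormedAddCommGroup F] [InnerProductSpace ℝ F]
    (hF : Module.finrank ℝ F = 2) {K : Set F} (hK : Convex ℝ K) (hIntg : (interior K).Nonempty)
    {z : ℝ → F} (hz : Continuous z) (hper : Function.Periodic z 1)
    (hinj : ∀ s t, z s = z t → ∃ k : ℤ, s - t = k) (hsub : range z ⊆ frontier K) :
    range z = frontier K := by
  refine hsub.antisymm fun x hx => ?_
  by_contra hxz
  obtain ⟨c, hc⟩ := hIntg
  have hne {y : F} (hy : y ∈ frontier K) : 0 < ‖y - c‖ :=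
    norm_pos_iff.2 (sub_ne_zero.2 fun h => hy.2 (h ▸ hc))
  obtain ⟨a, ha⟩ : ∃ a, a = ‖x - c‖⁻¹ • (x - c) := ⟨_, rfl⟩
  have ha1 : ‖a‖ = 1 := by
    rw [ha, norm_smul, norm_inv, norm_norm, inv_mul_cancel₀ (hne hx).ne']
  obtain ⟨b, hb1, hab⟩ := exists_unit_orthogonal hF ha1
  have hdec := eq_smul_add_smul_of_finrank_eq_two hF ha1 hb1 hab
  have hnorm (y : F) : ‖y‖ ^ 2 = ⟪a, y⟫ ^ 2 + ⟪b, y⟫ ^ 2 := by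
    rw [← real_inner_self_eq_norm_sq]
    nth_rw 1 [hdec y]
    rw [inner_add_left, real_inner_smul_left, real_inner_smul_left]
    ring
  have hlt (t : ℝ) : 0 < ‖z t - c‖ - ⟪a, z t - c⟫ := by
    have h1 : ⟪a, z t - c⟫ ≤ ‖z t - c‖ := by
      simpa [ha1] using real_inner_le_norm a (z t - c)
    refine lt_of_le_of_ne (sub_nonneg.2 h1) fun h0 => ?_
    have h2 : ⟪a, z t - c⟫ = ‖z t - c‖ := by linarith
    have h3 := hnorm (z t - c)
    rw [h2] at h3
    have h4 : ⟪b, z t - c⟫ = 0 := by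
      apply pow_eq_zero_iff (two_ne_zero) |>.1; linarith
    have h5 := hdec (z t - c)
    rw [h2, h4, zero_smul, add_zero, ha, smul_smul] at h5
    refine hxz ⟨t, hK.eq_of_mem_frontier_of_sub_eq_smul hc (hsub ⟨t, rfl⟩) hx
      (mul_pos (hne (hsub ⟨t, rfl⟩)) (inv_pos.2 (hne hx))) h5⟩
  -- the stereographic coordinate of the direction of `z t - c`
  let f : ℝ → ℝ := fun t => ⟪b, z t - c⟫ / (‖z t - c‖ - ⟪a, z t - c⟫)
  have hf : Continuous f := by
    refine Continuous.div (by fun_prop) (by fun_prop) fun t => (hlt t).ne'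
  have hfper : Function.Periodic f 1 := fun t => by simp only [f, hper t]
  obtain ⟨t, ht⟩ : ∃ t, f t - f (t + 1 / 2) = 0 := by
    have hg : Continuous fun t => f t - f (t + 1 / 2) := by fun_prop
    have h1 : f (1 / 2) - f (1 / 2 + 1 / 2) = -(f 0 - f (0 + 1 / 2)) := by
      rw [show (1 / 2 + 1 / 2 : ℝ) = 0 + 1 by norm_num, hfper 0, zero_add]
      ring
    exact mem_range_of_exists_le_of_exists_ge hg
      (by
        rcases le_total (f 0 - f (0 + 1 / 2)) 0 with h | h
        · exact ⟨0, h⟩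
        · exact ⟨1 / 2, by rw [h1]; linarith⟩)
      (by
        rcases le_total (f 0 - f (0 + 1 / 2)) 0 with h | h
        · exact ⟨1 / 2, by rw [h1]; linarith⟩
        · exact ⟨0, h⟩)
  have hcoord (s : ℝ) : z s - c = (‖z s - c‖ / (1 + f s ^ 2)) •
      ((f s ^ 2 - 1) • a + (2 * f s) • b) := by
    have h1 := hnorm (z s - c)
    have h2 := hlt s
    have h3 : f s * (‖z s - c‖ - ⟪a, z s - c⟫) = ⟪b, z s - c⟫ := div_mul_cancel₀ _ h2.ne'
    have h4 : 0 < 1 + f s ^ 2 := by positivity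
    have h5 : f s ^ 2 * (‖z s - c‖ - ⟪a, z s - c⟫) = ‖z s - c‖ + ⟪a, z s - c⟫ := by
      apply mul_right_cancel₀ h2.ne'
      linear_combination (f s * (‖z s - c‖ - ⟪a, z s - c⟫) + ⟪b, z s - c⟫) * h3 - h1
    have hA : ⟪a, z s - c⟫ = ‖z s - c‖ / (1 + f s ^ 2) * (f s ^ 2 - 1) := by
      rw [div_mul_eq_mul_div, eq_div_iff h4.ne']
      linear_combination -h5
    have hB : ⟪b, z s - c⟫ = ‖z s - c‖ / (1 + f s ^ 2) * (2 * f s) := by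
      rw [← h3, hA]
      field_simp
      ring
    conv_lhs => rw [hdec (z s - c), hA, hB]
    rw [smul_add, smul_smul, smul_smul]
  have hfeq : f t = f (t + 1 / 2) := by linarith
  have h1 := hcoord t
  have h2 := hcoord (t + 1 / 2)
  rw [← hfeq] at h2
  have hN1 := hne (hsub ⟨t, rfl⟩)
  have hN2 := hne (hsub ⟨t + 1 / 2, rfl⟩)
  have h3 : z t - c = (‖z t - c‖ / ‖z (t + 1 / 2) - c‖) • (z (t + 1 / 2) - c) := by
    generalize ‖z t - c‖ = N₁ at *
    generalize ‖z (t + 1 / 2) - c‖ = N₂ at *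
    rw [h1, h2, smul_smul, div_mul_div_cancel₀ hN2.ne']
  have h4 := hK.eq_of_mem_frontier_of_sub_eq_smul hc (hsub ⟨t, rfl⟩) (hsub ⟨t + 1 / 2, rfl⟩)
    (div_pos hN1 hN2) h3
  obtain ⟨k, hk⟩ := hinj _ _ h4
  have h5 : ((2 * k : ℤ) : ℝ) = ((-1 : ℤ) : ℝ) := by push_cast; linarith
  have h6 : 2 * k = -1 := by exact_mod_cast h5
  omega

end PlaneConvex

section ConvexLoop

open Filter Topology InnerProductGeometry

variable {E : Type*} [NormedAddCommGroup E] [InnerProductSpace ℝ E] {γ : ℝ → E} {u : ℝ} {e m : E}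

theorem finrank_span_orthonormal_pair (he : ‖e‖ = 1) (hm : ‖m‖ = 1) (hem : ⟪e, m⟫ = 0) :
    Module.finrank ℝ (Submodule.span ℝ {e, m}) = 2 := by
  have hon : Orthonormal ℝ ![e, m] := by
    simp [orthonormal_vecCons_iff, he, hm, hem]
  have := finrank_span_eq_card hon.linearIndependent
  rwa [Matrix.range_cons_cons_empty, Fintype.card_fin] at this

theorem HasDerivAt.inner_eq_zero_of_nonneg (hd : HasDerivAt γ e u) {ν : E}
    (h : ∀ s, 0 ≤ ⟪ν, γ s - γ u⟫) : ⟪ν, e⟫ = 0 := by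
  have h1 : HasDerivAt (fun s => ⟪ν, γ s - γ u⟫) ⟪ν, e⟫ u := by
    simpa using (hasDerivAt_const u ν).inner ℝ (hd.sub_const (γ u))
  refine IsLocalMin.hasDerivAt_eq_zero (Eventually.of_forall fun s => ?_) h1
  simpa using h s

theorem LiesInHalfPlane.norm_projPerp (hp : LiesInHalfPlane γ u e m) (s : ℝ) :
    ‖projPerp e (γ s - γ u)‖ = ⟪m, γ s - γ u⟫ := by
  rw [← sq_eq_sq₀ (norm_nonneg _) (hp.nonneg s), norm_projPerp_sq hp.norm_left, hp.norm_sq_eq s]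
  ring

theorem LiesInHalfPlane.eq_norm_smul (hp : LiesInHalfPlane γ u e m) (s : ℝ) :
    γ s - γ u =
      ‖γ s - γ u‖ • (cos (angle e (γ s - γ u)) • e + sin (angle e (γ s - γ u)) • m) := by
  have := hp.eq_smul_add_smul s
  rw [hp.inner_left_eq, hp.inner_right_eq] at this
  rwa [smul_add, smul_smul, smul_smul, mul_comm, mul_comm ‖_‖ (sin _)]

theorem sub_mem_direction_of_mem_intrinsicFrontier {K : Set E} {x y : E}
    (hx : x ∈ intrinsicFrontier ℝ K) (hy : y ∈ intrinsicFrontier ℝ K) :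
    x - y ∈ (affineSpan ℝ K).direction :=
  AffineSubspace.vsub_mem_direction
    (intrinsicClosure_subset_affineSpan (intrinsicFrontier_subset_intrinsicClosure hx))
    (intrinsicClosure_subset_affineSpan (intrinsicFrontier_subset_intrinsicClosure hy))

variable [FiniteDimensional ℝ E]

theorem HasDerivAt.mem_of_forall_sub_mem {V : Submodule ℝ E} (hd : HasDerivAt γ e u)
    (hV : ∀ s, γ s - γ u ∈ V) : e ∈ V :=
  V.closed_of_finiteDimensional.mem_of_tendsto (hasDerivAt_iff_tendsto_slope.1 hd)
    (Eventually.of_forall fun s => V.smul_mem _ (hV s))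

theorem LiesInHalfPlane.of_inner_nonneg {V : Submodule ℝ E} (hV : Module.finrank ℝ V = 2)
    (hsub : ∀ s, γ s - γ u ∈ V) (he : ‖e‖ = 1) (hd : HasDerivAt γ e u) {ν : E} (hν : ν ∈ V)
    (hν0 : ν ≠ 0) (h : ∀ s, 0 ≤ ⟪ν, γ s - γ u⟫) : LiesInHalfPlane γ u e (‖ν‖⁻¹ • ν) := by
  have hm1 : ‖‖ν‖⁻¹ • ν‖ = 1 := norm_smul_inv_norm hν0
  have hem : ⟪e, ‖ν‖⁻¹ • ν⟫ = 0 := by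
    rw [real_inner_smul_right, real_inner_comm, hd.inner_eq_zero_of_nonneg h, mul_zero]
  refine ⟨he, hm1, hem, fun s => ?_, fun s => ?_⟩
  · exact congrArg Subtype.val (eq_smul_add_smul_of_finrank_eq_two hV
      (a := ⟨e, hd.mem_of_forall_sub_mem hsub⟩) (b := ⟨‖ν‖⁻¹ • ν, V.smul_mem _ hν⟩) he hm1 hem
      ⟨γ s - γ u, hsub s⟩)
  · rw [real_inner_smul_left]
    exact mul_nonneg (by positivity) (h s)

/-- Every round circle is the relative boundary of a planar convex set. -/
theorem IsCircle.exists_convex {S : Set E} (hS : IsCircle S) :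
    ∃ K : Set E, Convex ℝ K ∧ Module.finrank ℝ (affineSpan ℝ K).direction = 2 ∧
      S = intrinsicFrontier ℝ K := by
  obtain ⟨c, r, V, hr, hV, rfl⟩ := hS
  set K : Set E := {x | ‖x - c‖ ≤ r ∧ x - c ∈ V} with hKdef
  have hK : Convex ℝ K := by
    intro x hx y hy a b ha hb hab
    have h1 : a • x + b • y - c = a • (x - c) + b • (y - c) := by
      rw [smul_sub, smul_sub, sub_add_sub_comm, ← add_smul, hab, one_smul]
    refine ⟨?_, h1 ▸ V.add_mem (V.smul_mem _ hx.2) (V.smul_mem _ hy.2)⟩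
    rw [h1]
    calc ‖a • (x - c) + b • (y - c)‖ ≤ ‖a • (x - c)‖ + ‖b • (y - c)‖ := norm_add_le _ _
      _ = a * ‖x - c‖ + b * ‖y - c‖ := by
        rw [norm_smul, norm_smul, norm_of_nonneg ha, norm_of_nonneg hb]
      _ ≤ a * r + b * r := by gcongr; exacts [hx.1, hy.1]
      _ = r := by rw [← add_mul, hab, one_mul]
  have hc : c ∈ K := by simp [hKdef, hr.le]
  have hdir : (affineSpan ℝ K).direction = V := by
    apply le_antisymm
    · rw [direction_affineSpan, vectorSpan_def, Submodule.span_le]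
      rintro _ ⟨x, hx, y, hy, rfl⟩
      simpa using V.sub_mem hx.2 hy.2
    · intro v hv
      rcases eq_or_ne v 0 with rfl | hv0
      · exact zero_mem _
      have hv' := norm_pos_iff.2 hv0
      have h1 : (r / ‖v‖) • v + c ∈ K := by
        refine ⟨?_, by simpa using V.smul_mem _ hv⟩
        rw [add_sub_cancel_right, norm_smul, norm_div, norm_norm, norm_of_nonneg hr.le,
          div_mul_cancel₀ _ hv'.ne']
      have h2 := AffineSubspace.vsub_mem_direction (subset_affineSpan ℝ K h1)
        (subset_affineSpan ℝ K hc)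
      rw [vsub_eq_sub, add_sub_cancel_right] at h2
      exact (Submodule.smul_mem_iff _ (div_pos hr hv').ne').1 h2
  have hclosed : IsClosed K :=
    (isClosed_le (f := fun x => ‖x - c‖) (by fun_prop) continuous_const).inter
      (V.closed_of_finiteDimensional.preimage (f := fun x => x - c) (by fun_prop))
  refine ⟨K, hK, hdir ▸ hV, Subset.antisymm ?_ ?_⟩
  · rintro x ⟨hxr, hxV⟩
    refine hK.mem_intrinsicFrontier_of_inner_nonneg (ν := c - x) ⟨hxr.le, hxV⟩ ?_ ?_ ?_
    · rw [hdir, ← neg_sub]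
      exact V.neg_mem hxV
    · rw [← norm_pos_iff, norm_sub_rev, hxr]
      exact hr
    · intro y hy
      have h1 : ⟪c - x, y - x⟫ = ‖x - c‖ ^ 2 - ⟪x - c, y - c⟫ := by
        rw [← real_inner_self_eq_norm_sq, ← inner_sub_right, ← neg_sub x c, inner_neg_left,
          ← inner_neg_right]
        congr 1
        abel
      have h2 := real_inner_le_norm (x - c) (y - c)
      rw [hxr] at h1 h2
      nlinarith [hy.1]
  · intro x hx
    have hxK : x ∈ K := by
      rw [← (hclosed.preimage continuous_subtype_val).intrinsicClosure (𝕜 := ℝ)]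
      exact intrinsicFrontier_subset_intrinsicClosure hx
    refine ⟨hxK.1.antisymm ?_, hxK.2⟩
    by_contra! hlt
    obtain ⟨ν, hν, hν0, hsupp, -⟩ := hK.exists_inner_nonneg hx
    rw [hdir] at hν
    have hν' := norm_pos_iff.2 hν0
    have ht : 0 < (r - ‖x - c‖) / ‖ν‖ := div_pos (sub_pos.2 hlt) hν'
    have h1 := hsupp (x - ((r - ‖x - c‖) / ‖ν‖) • ν) ⟨?_, ?_⟩
    · rw [sub_sub_cancel_left, inner_neg_right, real_inner_smul_right,
        real_inner_self_eq_norm_sq] at h1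
      have : 0 < (r - ‖x - c‖) / ‖ν‖ * ‖ν‖ ^ 2 := by positivity
      linarith
    · rw [sub_right_comm]
      refine (norm_sub_le _ _).trans ?_
      rw [norm_smul, norm_of_nonneg ht.le, div_mul_cancel₀ _ hν'.ne']
      linarith
    · rw [sub_right_comm]
      exact V.sub_mem hxK.2 (V.smul_mem _ hν)

theorem tpKernel_eq_of_circle {c : E} {r : ℝ} {V : Submodule ℝ E} (hr : 0 < r)
    (hV : Module.finrank ℝ V = 2) (hcirc : ∀ s, ‖γ s - c‖ = r ∧ γ s - c ∈ V) {s t : ℝ}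
    (hd : DifferentiableAt ℝ γ s) (he : ‖deriv γ s‖ = 1) (hne : γ t ≠ γ s) :
    tpKernel γ s t = 1 / (2 * r) := by
  have hin (a) : ⟪c - γ s, γ a - γ s⟫ = ‖γ a - γ s‖ ^ 2 / 2 := by
    have h1 : γ a - c = (γ a - γ s) - (c - γ s) := by abel
    have h2 := norm_sub_sq_real (γ a - γ s) (c - γ s)
    rw [← h1, (hcirc a).1, norm_sub_rev c, (hcirc s).1, real_inner_comm] at h2
    linarith
  have hν : ‖c - γ s‖ = r := by rw [norm_sub_rev, (hcirc s).1]
  have hp := LiesInHalfPlane.of_inner_nonneg hV (ν := c - γ s)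
    (fun a => by simpa using V.sub_mem (hcirc a).2 (hcirc s).2) he hd.hasDerivAt
    (by simpa using V.neg_mem (hcirc s).2) (norm_pos_iff.1 (hν ▸ hr))
    (fun a => by rw [hin]; positivity)
  have hN : 0 < ‖γ t - γ s‖ := norm_pos_iff.2 (sub_ne_zero.2 hne)
  rw [tpKernel, hp.norm_projPerp, real_inner_smul_left, hin, hν]
  field_simp

namespace IsArcLoop

/-- A closed curve contained in the relative boundary of a planar convex set covers it. -/
theorem range_eq_intrinsicFrontier (h : IsArcLoop γ) {K : Set E} (hK : Convex ℝ K)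
    (hdim : Module.finrank ℝ (affineSpan ℝ K).direction = 2)
    (hsub : range γ ⊆ intrinsicFrontier ℝ K) : range γ = intrinsicFrontier ℝ K := by
  have hne : K.Nonempty := by
    rw [nonempty_iff_ne_empty]
    rintro rfl
    simpa using hsub (mem_range_self 0)
  obtain ⟨p, K', hK', hIntg, -, -, hfr⟩ := hK.exists_image_direction hne
  rw [hfr] at hsub
  choose z hz hzγ using fun s => hsub (mem_range_self s)
  have hz' (s) : (z s : E) = γ s - p := eq_sub_of_add_eq (hzγ s)
  have hcont : Continuous z := by
    rw [Topology.IsEmbedding.subtypeVal.continuous_iff]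
    exact (h.continuous.sub continuous_const).congr fun s => (hz' s).symm
  have hper : Function.Periodic z 1 := fun s => Subtype.ext <| by rw [hz', hz', h.periodic]
  have hinj (s t) (hst : z s = z t) : ∃ k : ℤ, s - t = k :=
    h.inj s t (by rw [← hzγ s, ← hzγ t, hst])
  have := Convex.range_eq_frontier hdim hK' hIntg hcont hper hinj (range_subset_iff.2 hz)
  rw [hfr, ← this, ← range_comp]
  exact congrArg range (funext fun s => (hzγ s).symm)

theorem isCircle_range (h : IsArcLoop γ) {S : Set E} (hS : IsCircle S) (hsub : range γ ⊆ S) :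
    IsCircle (range γ) := by
  obtain ⟨K, hK, hdim, rfl⟩ := hS.exists_convex
  rwa [h.range_eq_intrinsicFrontier hK hdim hsub]

theorem tpFrom_le_pi_of_convex (h : IsArcLoop γ) {K : Set E} (hK : Convex ℝ K)
    (hdim : Module.finrank ℝ (affineSpan ℝ K).direction = 2)
    (hsub : range γ ⊆ intrinsicFrontier ℝ K) (he : ‖e‖ = 1) (hd : HasDerivAt γ e u) :
    tpFrom γ u ≤ ENNReal.ofReal π := by
  have hmem (s) : γ s ∈ intrinsicFrontier ℝ K := hsub (mem_range_self s)
  have hV (s t) := sub_mem_direction_of_mem_intrinsicFrontier (hmem s) (hmem t)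
  obtain ⟨ν, hν, hν0, -, hνs⟩ := hK.exists_inner_nonneg (hmem u)
  have hp := LiesInHalfPlane.of_inner_nonneg hdim (fun s => hV s u) he hd hν hν0
    fun s => hνs _ (hmem s)
  refine h.tpFrom_le_pi hp (h.monotoneOn_angle he hd ?_)
  have key {s t : ℝ} (hs : s ∈ Ioo u (u + 1)) (ht : t ∈ Ioo u (u + 1))
      (hst : angle e (γ s - γ u) = angle e (γ t - γ u)) (h0 : 0 < angle e (γ s - γ u))
      (hπ : angle e (γ s - γ u) < π) : ‖γ t - γ u‖ ≤ ‖γ s - γ u‖ := by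
    by_contra! hlt
    have hNs : 0 < ‖γ s - γ u‖ := norm_pos_iff.2 (h.sub_ne_zero hs)
    obtain ⟨μ, hμ, hμ0, -, hμs⟩ := hK.exists_inner_nonneg (hmem s)
    have h1 : γ t - γ u = (‖γ t - γ u‖ / ‖γ s - γ u‖) • (γ s - γ u) := by
      have h2 := hp.eq_norm_smul t
      rwa [← hst, (eq_inv_smul_iff₀ hNs.ne').2 (hp.eq_norm_smul s).symm, smul_smul,
        ← div_eq_mul_inv] at h2
    have h2 := hμs _ (hmem u)
    have h3 := hμs _ (hmem t)
    rw [← neg_sub, inner_neg_right] at h2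
    rw [← sub_sub_sub_cancel_right _ _ (γ u), inner_sub_right, h1, real_inner_smul_right,
      ← sub_one_mul] at h3
    have h4 : 0 < ‖γ t - γ u‖ / ‖γ s - γ u‖ - 1 := by rwa [sub_pos, one_lt_div hNs]
    have h5 : ⟪μ, γ s - γ u⟫ = 0 :=
      le_antisymm (by linarith) (nonneg_of_mul_nonneg_right h3 h4)
    have h6 (a : ℝ) : 0 ≤ ⟪μ, γ a - γ u⟫ := by
      have := hμs _ (hmem a)
      rwa [← sub_sub_sub_cancel_right _ _ (γ u), inner_sub_right, h5, sub_zero] at this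
    have hp' := LiesInHalfPlane.of_inner_nonneg hdim (fun s => hV s u) he hd hμ hμ0 h6
    have h7 := hp'.inner_right_eq s
    rw [real_inner_smul_left, h5, mul_zero] at h7
    exact (mul_pos (sin_pos_of_pos_of_lt_pi h0 hπ) hNs).ne h7
  intro s hs t ht hst h0 hπ
  have hN : ‖γ s - γ u‖ = ‖γ t - γ u‖ :=
    le_antisymm (key ht hs hst.symm (hst ▸ h0) (hst ▸ hπ)) (key hs ht hst h0 hπ)
  have hΔ : γ s = γ t := by
    have h1 := hp.eq_norm_smul s
    rwa [hst, hN, ← hp.eq_norm_smul t, sub_left_inj] at h1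
  obtain ⟨k, hk⟩ := h.inj s t hΔ
  have h1 : (-1 : ℝ) < k := by rw [← hk]; linarith [hs.1, ht.2]
  have h2 : (k : ℝ) < 1 := by rw [← hk]; linarith [hs.2, ht.1]
  have hk0 : k = 0 := by
    have h1' : (-1 : ℤ) < k := by exact_mod_cast h1
    have h2' : k < 1 := by exact_mod_cast h2
    omega
  rw [hk0, Int.cast_zero] at hk
  linarith

/-- If the curve has minimal energy seen from almost every one of its points, it is convex. -/
theorem exists_convex_of_tpFrom_le (h : IsArcLoop γ)
    (hae : ∀ᵐ u, tpFrom γ u ≤ ENNReal.ofReal π) :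
    ∃ K : Set E, Convex ℝ K ∧ Module.finrank ℝ (affineSpan ℝ K).direction = 2 ∧
      range γ = intrinsicFrontier ℝ K := by
  set K := convexHull ℝ (range γ) with hKdef
  have hK : Convex ℝ K := convex_convexHull ℝ _
  have hγK (s) : γ s ∈ K := subset_convexHull ℝ _ (mem_range_self s)
  have hV (s t) : γ s - γ t ∈ (affineSpan ℝ K).direction :=
    AffineSubspace.vsub_mem_direction (subset_affineSpan ℝ K (hγK s)) (subset_affineSpan ℝ K (hγK t))
  have hgood : ∀ᵐ u, HasDerivAt γ (deriv γ u) u ∧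
      ∃ m ∈ (affineSpan ℝ K).direction, LiesInHalfPlane γ u (deriv γ u) m := by
    filter_upwards [hae, h.speed] with u hu hs
    obtain ⟨m, hp, c, r, rfl⟩ := h.exists_liesInHalfPlane hs.2 hs.1.hasDerivAt hu
    exact ⟨hs.1.hasDerivAt, _, Submodule.smul_mem _ _ (hV c u), hp⟩
  have hdim : Module.finrank ℝ (affineSpan ℝ K).direction = 2 := by
    obtain ⟨u, hd, m, hm, hp⟩ := hgood.exists
    rw [← finrank_span_orthonormal_pair hp.norm_left hp.norm_right hp.inner_eq_zero]
    suffices (affineSpan ℝ K).direction = Submodule.span ℝ {deriv γ u, m} by rw [this]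
    apply le_antisymm
    · rw [hKdef, affineSpan_convexHull, direction_affineSpan,
        vectorSpan_range_eq_span_range_vsub_right ℝ γ u, Submodule.span_le]
      rintro _ ⟨s, rfl⟩
      exact Submodule.mem_span_pair.2 ⟨_, _, (hp.eq_smul_add_smul s).symm⟩
    · rw [Submodule.span_le, pair_subset_iff]
      exact ⟨hd.mem_of_forall_sub_mem fun s => hV s u, hm⟩
  refine ⟨K, hK, hdim, h.range_eq_intrinsicFrontier hK hdim (range_subset_iff.2 ?_)⟩
  have hfr : ∀ᵐ u, γ u ∈ intrinsicFrontier ℝ K := by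
    filter_upwards [hgood] with u hu
    obtain ⟨-, m, hm, hp⟩ := hu
    have hm0 : m ≠ 0 := by
      rintro rfl
      simpa using hp.norm_right
    refine hK.mem_intrinsicFrontier_of_inner_nonneg (hγK u) hm hm0 fun y hy => ?_
    have h1 : K ⊆ {y | ⟪m, γ u⟫ ≤ innerSL ℝ m y} := by
      refine convexHull_min (range_subset_iff.2 fun s => ?_)
        (convex_halfSpace_ge (innerSL ℝ m).toLinearMap.isLinear _)
      have := hp.nonneg s
      rw [inner_sub_right] at this
      simpa using this
    rw [inner_sub_right]
    exact sub_nonneg.2 (h1 hy)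
  have hcl : IsClosed {u | γ u ∈ intrinsicFrontier ℝ K} :=
    (isClosed_intrinsicFrontier (AffineSubspace.closed_of_finiteDimensional _)).preimage h.continuous
  have := (Measure.dense_of_ae hfr).closure_eq
  rw [hcl.closure_eq] at this
  exact fun u => (this ▸ mem_univ u : u ∈ {u | γ u ∈ intrinsicFrontier ℝ K})

theorem isCircle_range_of_tpKernel (h : IsArcLoop γ) {s κ : ℝ} (hκ : 0 < κ)
    (hp : LiesInHalfPlane γ s (deriv γ s) m) (hae : ∀ᵐ t, tpKernel γ s t = κ) :
    IsCircle (range γ) := by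
  have hγ := h.continuous
  have hall : (fun t => ⟪m, γ t - γ s⟫) = fun t => κ * ‖γ t - γ s‖ ^ 2 := by
    rw [← Continuous.ae_eq_iff_eq volume (by fun_prop) (by fun_prop)]
    filter_upwards [hae] with t ht
    rcases eq_or_ne (γ t) (γ s) with heq | hne
    · simp [heq]
    · rw [← ht, tpKernel, hp.norm_projPerp, div_mul_cancel₀]
      exact pow_ne_zero 2 (norm_ne_zero_iff.2 (_root_.sub_ne_zero.2 hne))
  refine h.isCircle_range ⟨γ s + (2 * κ)⁻¹ • m, (2 * κ)⁻¹, _, by positivity,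
    finrank_span_orthonormal_pair hp.norm_left hp.norm_right hp.inner_eq_zero, rfl⟩
    (range_subset_iff.2 fun t => ⟨?_, ?_⟩)
  · rw [← sq_eq_sq₀ (norm_nonneg _) (by positivity), ← sub_sub, norm_sub_sq_real,
      real_inner_smul_right, real_inner_comm, congrFun hall t, norm_smul, hp.norm_right, mul_one,
      norm_of_nonneg (by positivity)]
    field_simp
    ring
  · rw [← sub_sub]
    exact Submodule.sub_mem _ (Submodule.mem_span_pair.2 ⟨_, _, (hp.eq_smul_add_smul t).symm⟩)
      (Submodule.smul_mem _ _ (Submodule.subset_span (by simp)))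

end IsArcLoop

end ConvexLoop

section Jensen

variable {α : Type*} [MeasurableSpace α] {μ : Measure α} {f : α → ℝ} {a q : ℝ}

theorem rpow_tangent_le {x : ℝ} (ha : 0 < a) (hx : 0 ≤ x) (hq : 1 ≤ q) :
    q * a ^ (q - 1) * x ≤ x ^ q + (q - 1) * a ^ q := by
  have h1 := one_add_mul_self_le_rpow_one_add
    (show -1 ≤ x / a - 1 by linarith [div_nonneg hx ha.le]) hq
  rw [add_sub_cancel, div_rpow hx ha.le, le_div_iff₀ (rpow_pos_of_pos ha q)] at h1
  have h2 : a ^ q = a ^ (q - 1) * a := by rw [← rpow_add_one ha.ne', sub_add_cancel]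
  have h3 : a ^ q * (x / a) = a ^ (q - 1) * x := by rw [h2]; field_simp
  linear_combination h1 - q * h3

theorem rpow_tangent_lt {x : ℝ} (ha : 0 < a) (hx : 0 ≤ x) (hxa : x ≠ a) (hq : 1 < q) :
    q * a ^ (q - 1) * x < x ^ q + (q - 1) * a ^ q := by
  have h1 := one_add_mul_self_lt_rpow_one_add
    (show -1 ≤ x / a - 1 by linarith [div_nonneg hx ha.le])
    (sub_ne_zero.2 fun h => hxa ((div_eq_one_iff_eq ha.ne').1 h)) hq
  rw [add_sub_cancel, div_rpow hx ha.le, lt_div_iff₀ (rpow_pos_of_pos ha q)] at h1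
  have h2 : a ^ q = a ^ (q - 1) * a := by rw [← rpow_add_one ha.ne', sub_add_cancel]
  have h3 : a ^ q * (x / a) = a ^ (q - 1) * x := by rw [h2]; field_simp
  linear_combination h1 - q * h3

theorem lintegral_rpow_add [IsProbabilityMeasure μ] (f : α → ℝ) (a q : ℝ) :
    ∫⁻ x, ENNReal.ofReal (f x ^ q) + ENNReal.ofReal ((q - 1) * a ^ q) ∂μ =
      ∫⁻ x, ENNReal.ofReal (f x ^ q) ∂μ + ENNReal.ofReal ((q - 1) * a ^ q) := by
  rw [lintegral_add_right _ measurable_const, lintegral_const, measure_univ, mul_one]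

theorem lintegral_tangent (hf : Measurable f) (ha : 0 < a) (hq : 1 ≤ q) :
    ∫⁻ x, ENNReal.ofReal (q * a ^ (q - 1) * f x) ∂μ =
      ENNReal.ofReal (q * a ^ (q - 1)) * ∫⁻ x, ENNReal.ofReal (f x) ∂μ := by
  rw [← lintegral_const_mul _ hf.ennreal_ofReal]
  refine lintegral_congr fun x => ENNReal.ofReal_mul ?_
  have := rpow_pos_of_pos ha (q - 1)
  positivity

theorem ofReal_tangent_eq (ha : 0 < a) (hq : 1 ≤ q) :
    ENNReal.ofReal (q * a ^ (q - 1)) * ENNReal.ofReal a =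
      ENNReal.ofReal (a ^ q) + ENNReal.ofReal ((q - 1) * a ^ q) := by
  have h1 := rpow_pos_of_pos ha (q - 1)
  have h2 := rpow_pos_of_pos ha q
  rw [← ENNReal.ofReal_mul (by positivity), ← ENNReal.ofReal_add h2.le
    (mul_nonneg (by linarith) h2.le), mul_assoc, ← rpow_add_one ha.ne', sub_add_cancel]
  congr 1
  ring

theorem ofReal_rpow_le_lintegral [IsProbabilityMeasure μ] (hf : Measurable f) (h0 : ∀ x, 0 ≤ f x)
    (ha : 0 < a) (hq : 1 ≤ q) (h : ENNReal.ofReal a ≤ ∫⁻ x, ENNReal.ofReal (f x) ∂μ) :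
    ENNReal.ofReal (a ^ q) ≤ ∫⁻ x, ENNReal.ofReal (f x ^ q) ∂μ := by
  rw [← ENNReal.add_le_add_iff_right (ENNReal.ofReal_ne_top (r := (q - 1) * a ^ q)),
    ← lintegral_rpow_add f a q, ← ofReal_tangent_eq ha hq]
  calc _ ≤ ENNReal.ofReal (q * a ^ (q - 1)) * ∫⁻ x, ENNReal.ofReal (f x) ∂μ := by gcongr
    _ = ∫⁻ x, ENNReal.ofReal (q * a ^ (q - 1) * f x) ∂μ := (lintegral_tangent hf ha hq).symm
    _ ≤ _ := lintegral_mono fun x => by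
      rw [← ENNReal.ofReal_add (rpow_nonneg (h0 x) q)
        (mul_nonneg (by linarith) (rpow_nonneg ha.le q))]
      exact ENNReal.ofReal_le_ofReal (rpow_tangent_le ha (h0 x) hq)

theorem ae_eq_of_lintegral_rpow_le [IsProbabilityMeasure μ] (hf : Measurable f) (h0 : ∀ x, 0 ≤ f x)
    (ha : 0 < a) (hq : 1 < q) (h : ENNReal.ofReal a ≤ ∫⁻ x, ENNReal.ofReal (f x) ∂μ)
    (hle : ∫⁻ x, ENNReal.ofReal (f x ^ q) ∂μ ≤ ENNReal.ofReal (a ^ q)) : ∀ᵐ x ∂μ, f x = a := by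
  have hpt (x) : ENNReal.ofReal (q * a ^ (q - 1) * f x) ≤
      ENNReal.ofReal (f x ^ q) + ENNReal.ofReal ((q - 1) * a ^ q) := by
    rw [← ENNReal.ofReal_add (rpow_nonneg (h0 x) q)
      (mul_nonneg (by linarith) (rpow_nonneg ha.le q))]
    exact ENNReal.ofReal_le_ofReal (rpow_tangent_le ha (h0 x) hq.le)
  have hIntg : ∫⁻ x, ENNReal.ofReal (f x ^ q) + ENNReal.ofReal ((q - 1) * a ^ q) ∂μ ≤
      ∫⁻ x, ENNReal.ofReal (q * a ^ (q - 1) * f x) ∂μ := by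
    rw [lintegral_rpow_add f a q, lintegral_tangent hf ha hq.le]
    calc _ ≤ ENNReal.ofReal (a ^ q) + ENNReal.ofReal ((q - 1) * a ^ q) := by gcongr
      _ = ENNReal.ofReal (q * a ^ (q - 1)) * ENNReal.ofReal a := (ofReal_tangent_eq ha hq.le).symm
      _ ≤ _ := by gcongr
  have hfin : ∫⁻ x, ENNReal.ofReal (q * a ^ (q - 1) * f x) ∂μ ≠ ∞ := by
    refine ne_top_of_le_ne_top ?_ (lintegral_mono hpt)
    rw [lintegral_rpow_add f a q]
    exact ENNReal.add_ne_top.2 ⟨ne_top_of_le_ne_top ENNReal.ofReal_ne_top hle, ENNReal.ofReal_ne_top⟩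
  filter_upwards [ae_eq_of_ae_le_of_lintegral_le (ae_of_all _ hpt) hfin
    (((hf.pow_const q).ennreal_ofReal).add_const _).aemeasurable hIntg] with x hx
  by_contra hxa
  have h1 : 0 < q * a ^ (q - 1) := mul_pos (by linarith) (rpow_pos_of_pos ha _)
  rw [← ENNReal.ofReal_add (rpow_nonneg (h0 x) q)
    (mul_nonneg (by linarith) (rpow_nonneg ha.le q)),
    ENNReal.ofReal_eq_ofReal_iff (mul_nonneg h1.le (h0 x))
    (add_nonneg (rpow_nonneg (h0 x) q) (mul_nonneg (by linarith) (rpow_nonneg ha.le q)))] at hx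
  exact (rpow_tangent_lt ha (h0 x) hxa hq).ne hx

end Jensen

section Periodic

theorem Function.Periodic.setLIntegral_Ioc_eq {f : ℝ → ℝ≥0∞} {T : ℝ} (hf : Function.Periodic f T)
    (hT : 0 < T) (s t : ℝ) : ∫⁻ x in Ioc s (s + T), f x = ∫⁻ x in Ioc t (t + T), f x := by
  have : VAddInvariantMeasure (AddSubgroup.zmultiples T) ℝ volume :=
    ⟨fun c s _ => measure_preimage_add _ _ _⟩
  apply IsAddFundamentalDomain.setLIntegral_eq (G := AddSubgroup.zmultiples T)
  exacts [isAddFundamentalDomain_Ioc hT s, isAddFundamentalDomain_Ioc hT t,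
    hf.map_vadd_zmultiples]

theorem setLIntegral_Ioc_comp_add_left (f : ℝ → ℝ≥0∞) (u a b : ℝ) :
    ∫⁻ w in Ioc a b, f (u + w) = ∫⁻ t in Ioc (u + a) (u + b), f t := by
  have := (measurePreserving_add_left volume u).setLIntegral_comp_preimage_emb
    (measurableEmbedding_addLeft u) f (Ioc (u + a) (u + b))
  rwa [preimage_const_add_Ioc, add_sub_cancel_left, add_sub_cancel_left] at this

theorem ae_of_ae_restrict_Ioc {P : ℝ → Prop} (hP : Function.Periodic P 1)
    (h : ∀ᵐ x ∂volume.restrict (Ioc (0 : ℝ) 1), P x) : ∀ᵐ x, P x := by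
  rw [ae_restrict_iff' measurableSet_Ioc] at h
  have h1 : ∀ᵐ x : ℝ, ∀ k : ℤ, x + k ∈ Ioc (0 : ℝ) 1 → P (x + k) :=
    ae_all_iff.2 fun k => (measurePreserving_add_right volume (k : ℝ)).quasiMeasurePreserving.ae h
  filter_upwards [h1] with x hx
  obtain ⟨k, hk, -⟩ := existsUnique_add_zsmul_mem_Ioc one_pos x 0
  rw [zsmul_one, zero_add] at hk
  have := hx k hk
  rwa [← mul_one (k : ℝ), hP.int_mul k x] at this

end Periodic

section Energy

open Filter Topology

variable {E : Type*} [NormedAddCommGroup E] [InnerProductSpace ℝ E] {γ : ℝ → E}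

/-- The uniform probability measure on the fundamental domain `(0, 1]` of `ℝ/ℤ`. -/
abbrev unitMeasure : Measure ℝ := volume.restrict (Ioc (0 : ℝ) 1)

instance : IsProbabilityMeasure unitMeasure := ⟨by simp⟩

theorem Function.Periodic.deriv_one (h : Function.Periodic γ 1) : Function.Periodic (deriv γ) 1 :=
  fun s => by rw [← deriv_comp_add_const, h.funext]

theorem tpKernel_periodic_left (h : Function.Periodic γ 1) (t : ℝ) :
    Function.Periodic (fun s => tpKernel γ s t) 1 := fun s => by
  simp only [tpKernel, h.deriv_one s, h s]

theorem tpKernel_periodic_right (h : Function.Periodic γ 1) (s : ℝ) :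
    Function.Periodic (fun t => tpKernel γ s t) 1 := fun t => by
  simp only [tpKernel, h t]

theorem tpFrom_eq_lintegral (h : Function.Periodic γ 1) (u : ℝ) :
    tpFrom γ u = ∫⁻ s, ENNReal.ofReal (tpKernel γ s u) ∂unitMeasure := by
  have hper : Function.Periodic (fun s => ENNReal.ofReal (tpKernel γ s u)) 1 :=
    (tpKernel_periodic_left h u).comp ENNReal.ofReal
  rw [tpFrom, setLIntegral_congr Ioo_ae_eq_Ioc, hper.setLIntegral_Ioc_eq one_pos u 0, zero_add]

theorem tpFrom_periodic (h : Function.Periodic γ 1) : Function.Periodic (tpFrom γ) 1 := fun u => by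
  rw [tpFrom_eq_lintegral h, tpFrom_eq_lintegral h]
  simp only [tpKernel_periodic_right h _ u]

/-- The tangent-point energy for `p = 2 q`. -/
def tpEnergy (γ : ℝ → E) (q : ℝ) : ℝ≥0∞ :=
  ∫⁻ p, ENNReal.ofReal (tpKernel γ p.1 p.2 ^ q) ∂unitMeasure.prod unitMeasure

namespace IsArcLoop

theorem ae_pi_le_tpFrom (h : IsArcLoop γ) : ∀ᵐ u, ENNReal.ofReal π ≤ tpFrom γ u :=
  h.speed.mono fun _ hu => h.pi_le_tpFrom hu.2 hu.1.hasDerivAt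

theorem pi_le_lintegral_tpFrom (h : IsArcLoop γ) :
    ENNReal.ofReal π ≤ ∫⁻ u, tpFrom γ u ∂unitMeasure := by
  calc ENNReal.ofReal π = ∫⁻ _, ENNReal.ofReal π ∂unitMeasure := by simp
    _ ≤ _ := lintegral_mono_ae (ae_restrict_of_ae h.ae_pi_le_tpFrom)

theorem ae_ne (h : IsArcLoop γ) (s : ℝ) : ∀ᵐ t, γ t ≠ γ s := by
  refine ((countable_range fun k : ℤ => s + k).ae_notMem volume).mono fun t ht heq => ht ?_
  obtain ⟨k, hk⟩ := h.inj t s heq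
  exact ⟨k, by simp only; linarith⟩

variable [FiniteDimensional ℝ E]

theorem measurable_tpKernel (h : IsArcLoop γ) :
    Measurable fun p : ℝ × ℝ => tpKernel γ p.1 p.2 := by
  have hd : StronglyMeasurable fun p : ℝ × ℝ => deriv γ p.1 :=
    (stronglyMeasurable_deriv γ).comp_measurable measurable_fst
  have hΔ : StronglyMeasurable fun p : ℝ × ℝ => γ p.2 - γ p.1 := by
    have := h.continuous
    exact Continuous.stronglyMeasurable (by fun_prop)
  have hc := (hd.inner (𝕜 := ℝ) hΔ).measurable.div (hd.norm.measurable.pow_const 2)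
  exact ((hΔ.sub (hc.stronglyMeasurable.smul hd)).norm.measurable).div
    (hΔ.norm.measurable.pow_const 2)

theorem lintegral_tpKernel (h : IsArcLoop γ) :
    ∫⁻ p, ENNReal.ofReal (tpKernel γ p.1 p.2) ∂unitMeasure.prod unitMeasure =
      ∫⁻ u, tpFrom γ u ∂unitMeasure := by
  rw [lintegral_prod_symm _ h.measurable_tpKernel.ennreal_ofReal.aemeasurable]
  simp only [tpFrom_eq_lintegral h.periodic]

theorem measurable_tpFrom (h : IsArcLoop γ) : Measurable (tpFrom γ) := by
  simp only [funext (tpFrom_eq_lintegral h.periodic)]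
  exact h.measurable_tpKernel.ennreal_ofReal.lintegral_prod_left

theorem lintegral_tpFrom_eq_pi_iff (h : IsArcLoop γ) :
    ∫⁻ u, tpFrom γ u ∂unitMeasure = ENNReal.ofReal π ↔ ∀ᵐ u, tpFrom γ u ≤ ENNReal.ofReal π := by
  refine ⟨fun heq => ?_, fun hae => le_antisymm ?_ h.pi_le_lintegral_tpFrom⟩
  · refine ae_of_ae_restrict_Ioc (fun u => by rw [tpFrom_periodic h.periodic u]) ?_
    have := ae_eq_of_ae_le_of_lintegral_le (μ := unitMeasure) (f := fun _ => ENNReal.ofReal π)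
      (ae_restrict_of_ae h.ae_pi_le_tpFrom) (by simp) h.measurable_tpFrom.aemeasurable
      (by simp [heq])
    exact this.mono fun u hu => hu.ge
  · calc _ ≤ ∫⁻ _, ENNReal.ofReal π ∂unitMeasure := lintegral_mono_ae (ae_restrict_of_ae hae)
      _ = ENNReal.ofReal π := by simp

theorem pi_rpow_le_tpEnergy (h : IsArcLoop γ) {q : ℝ} (hq : 1 ≤ q) :
    ENNReal.ofReal (π ^ q) ≤ tpEnergy γ q :=
  ofReal_rpow_le_lintegral h.measurable_tpKernel (fun _ => tpKernel_nonneg _ _ _) pi_pos hq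
    (h.lintegral_tpKernel ▸ h.pi_le_lintegral_tpFrom)

theorem tpEnergy_one_eq_iff (h : IsArcLoop γ) :
    tpEnergy γ 1 = ENNReal.ofReal π ↔ ∃ K : Set E, Convex ℝ K ∧
      Module.finrank ℝ (affineSpan ℝ K).direction = 2 ∧ range γ = intrinsicFrontier ℝ K := by
  simp only [tpEnergy, rpow_one]
  rw [h.lintegral_tpKernel, h.lintegral_tpFrom_eq_pi_iff]
  refine ⟨h.exists_convex_of_tpFrom_le, fun ⟨K, hK, hdim, hr⟩ => ?_⟩
  exact h.speed.mono fun u hu => h.tpFrom_le_pi_of_convex hK hdim hr.subset hu.2 hu.1.hasDerivAt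

theorem isCircle_of_tpEnergy_eq (h : IsArcLoop γ) {q : ℝ} (hq : 1 < q)
    (heq : tpEnergy γ q = ENNReal.ofReal (π ^ q)) : IsCircle (range γ) := by
  have hae := ae_eq_of_lintegral_rpow_le h.measurable_tpKernel (fun _ => tpKernel_nonneg _ _ _)
    pi_pos hq (h.lintegral_tpKernel ▸ h.pi_le_lintegral_tpFrom) heq.le
  have hfrom : ∀ᵐ u, tpFrom γ u ≤ ENNReal.ofReal π := by
    rw [← h.lintegral_tpFrom_eq_pi_iff, ← h.lintegral_tpKernel]
    calc _ = ∫⁻ _, ENNReal.ofReal π ∂unitMeasure.prod unitMeasure :=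
          lintegral_congr_ae (hae.mono fun p hp => by simp only [hp])
      _ = ENNReal.ofReal π := by simp
  obtain ⟨s, hs, hd, hu⟩ := ((Measure.ae_ae_of_ae_prod hae).and
    ((ae_restrict_of_ae h.speed).and (ae_restrict_of_ae hfrom))).exists
  obtain ⟨m, hp, -⟩ := h.exists_liesInHalfPlane hd.2 hd.1.hasDerivAt hu
  refine h.isCircle_range_of_tpKernel pi_pos hp (ae_of_ae_restrict_Ioc (fun t => ?_) hs)
  rw [show tpKernel γ s (t + 1) = tpKernel γ s t from tpKernel_periodic_right h.periodic s t]

theorem tpEnergy_eq_of_isCircle (h : IsArcLoop γ) (hc : IsCircle (range γ)) (q : ℝ) :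
    tpEnergy γ q = ENNReal.ofReal (π ^ q) := by
  have h1 := h.tpEnergy_one_eq_iff.2 hc.exists_convex
  obtain ⟨c, r, V, hr, hV, hrange⟩ := hc
  have hcirc (s) : ‖γ s - c‖ = r ∧ γ s - c ∈ V := hrange.subset (mem_range_self s)
  have key (p : ℝ) : tpEnergy γ p = ENNReal.ofReal ((1 / (2 * r)) ^ p) := by
    rw [tpEnergy, lintegral_prod _ (h.measurable_tpKernel.pow_const p).ennreal_ofReal.aemeasurable]
    have hin : ∀ᵐ s ∂unitMeasure, ∫⁻ t, ENNReal.ofReal (tpKernel γ s t ^ p) ∂unitMeasure =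
        ENNReal.ofReal ((1 / (2 * r)) ^ p) := by
      filter_upwards [ae_restrict_of_ae h.speed] with s hs
      rw [lintegral_congr_ae (g := fun _ => ENNReal.ofReal ((1 / (2 * r)) ^ p))]
      · simp
      · filter_upwards [ae_restrict_of_ae (h.ae_ne s)] with t ht
        rw [tpKernel_eq_of_circle hr hV hcirc hs.1 hs.2 ht]
    rw [lintegral_congr_ae hin]
    simp
  rw [key, rpow_one, ENNReal.ofReal_eq_ofReal_iff (by positivity) pi_pos.le] at h1
  rw [key, h1]

end IsArcLoop

end Energy

namespace ClosedCurve

variable {n : ℕ} (γ : ClosedCurve n)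

theorem intervalIntegrable_deriv' (a b : ℝ) : IntervalIntegrable γ.deriv' volume a b :=
  γ.deriv'_periodic.intervalIntegrable₀ one_ne_zero
    ((intervalIntegrable_iff_integrableOn_Icc_of_le zero_le_one).2 γ.integrableOn) a b

theorem sub_eq_integral (s t : ℝ) : γ.toFun t - γ.toFun s = ∫ x in s..t, γ.deriv' x := by
  rw [γ.eq_integral t, γ.eq_integral s, add_sub_add_left_eq_sub,
    integral_interval_sub_left (γ.intervalIntegrable_deriv' _ _) (γ.intervalIntegrable_deriv' _ _)]

theorem ae_hasDerivAt : ∀ᵐ t, HasDerivAt γ.toFun (γ.deriv' t) t := by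
  have hloc : LocallyIntegrable γ.deriv' := by
    refine fun x => ⟨Icc (x - 1) (x + 1), Icc_mem_nhds (by linarith) (by linarith), ?_⟩
    exact (intervalIntegrable_iff_integrableOn_Icc_of_le (by linarith)).1
      (γ.intervalIntegrable_deriv' _ _)
  filter_upwards [LocallyIntegrable.ae_hasDerivAt_integral hloc] with t ht
  rw [funext γ.eq_integral]
  exact (ht 0).const_add _

variable {γ}

theorem isArcLoop (hinj : γ.IsInj) (harc : γ.IsArclength) : IsArcLoop γ.toFun where
  periodic := γ.periodic
  lipschitz := by
    refine LipschitzWith.of_dist_le_mul fun t s => ?_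
    rw [dist_eq_norm, γ.sub_eq_integral, NNReal.coe_one, dist_eq_norm]
    exact norm_integral_le_of_norm_le_const_ae (harc.mono fun x hx _ => hx.le)
  inj := hinj
  speed := by
    filter_upwards [γ.ae_hasDerivAt, harc] with t hd ht
    exact ⟨hd.differentiableAt, hd.deriv ▸ ht⟩

theorem TP_eq_tpEnergy (hinj : γ.IsInj) (harc : γ.IsArclength) (q : ℝ) :
    TP (2 * q) q γ = tpEnergy γ.toFun q := by
  have h := isArcLoop hinj harc
  rw [TP, tpEnergy,
    lintegral_prod _ (h.measurable_tpKernel.pow_const q).ennreal_ofReal.aemeasurable]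
  refine lintegral_congr_ae (ae_restrict_of_ae ?_)
  filter_upwards [γ.ae_hasDerivAt, harc] with u hd hu
  have hper : Function.Periodic (fun t => ENNReal.ofReal (tpKernel γ.toFun u t ^ q)) 1 :=
    (tpKernel_periodic_right h.periodic u).comp fun x => ENNReal.ofReal (x ^ q)
  have h1 := hper.setLIntegral_Ioc_eq one_pos 0 u
  rw [zero_add] at h1
  have h2 := setLIntegral_Ioc_comp_add_left
    (fun t => ENNReal.ofReal (tpKernel γ.toFun u t ^ q)) u 0 1
  rw [add_zero] at h2
  rw [h1, ← h2]
  refine lintegral_congr_ae (ae_restrict_of_ae ?_)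
  filter_upwards [(measurePreserving_add_left volume u).quasiMeasurePreserving.ae harc] with w hw
  rw [hu, hw, mul_one, mul_one, tpKernel, hd.deriv, div_rpow (norm_nonneg _) (by positivity),
    rpow_mul (norm_nonneg _), rpow_two]

end ClosedCurve

/-- **The geometric case `p = 2q`** (Theorem 5.2): `TP^{(2q,q)}(γ) ≥ π^q` for every
arc-length parametrized injective closed curve; for `q > 1` equality holds iff the image
of `γ` is a circle, and for `q = 1` equality holds iff `γ` is convex. -/
theorem tp_geometric_case {n : ℕ} (q : ℝ) (hq : 1 ≤ q) (γ : ClosedCurve n)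
    (hinj : γ.IsInj) (harc : γ.IsArclength) :
    ENNReal.ofReal (π ^ q) ≤ TP (2 * q) q γ ∧
    (1 < q → (TP (2 * q) q γ = ENNReal.ofReal (π ^ q) ↔ IsCircle (Set.range γ.toFun))) ∧
    (q = 1 → (TP (2 * q) q γ = ENNReal.ofReal (π ^ q) ↔ γ.IsConvex)) := by
  have h := ClosedCurve.isArcLoop hinj harc
  rw [ClosedCurve.TP_eq_tpEnergy hinj harc]
  refine ⟨h.pi_rpow_le_tpEnergy hq, fun hq1 => ⟨h.isCircle_of_tpEnergy_eq hq1, fun hc =>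
    h.tpEnergy_eq_of_isCircle hc q⟩, ?_⟩
  rintro rfl
  rw [rpow_one, h.tpEnergy_one_eq_iff]
  rfl

end
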